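/- arXiv:2108.00398 — 6 statements merged into one kernel-verified Lean document; each statement's English description precedes it below -/
import Mathlib

section
/- Let n ≥ 4. A ℂ-linear map D : ℂ^n → ℂ^n is a derivation of the (n−1)-ary algebra A_n if and only if its matrix (d_{st}) with respect to the standard basis e_1,…,e_n is antisymmetric, i.e., d_{ss} = 0 for all s and d_{st} + d_{ts} = 0 for all s ≠ t. -/
open scoped Matrix

/-- The infinitesimal form of the multiplicativity of the determinant. -/
theorem Matrix.sum_det_updateRow_mulVec {ι R : Type*} [Fintype ι] [DecidableEq ι] [CommRing R]
    (A M : Matrix ι ι R) :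
    ∑ j, (A.updateRow j (M *ᵥ A j)).det = M.trace * A.det := by
  have h : ∀ j, (A.updateRow j (M *ᵥ A j)).det = (A * Mᵀ * A.adjugate) j j := by
    intro j
    rw [← Matrix.cramer_transpose_apply, Matrix.cramer_eq_adjugate_mulVec,
      ← Matrix.adjugate_transpose, Matrix.mulVec_transpose, Matrix.mul_apply]
    simp only [Matrix.vecMul, dotProduct, Matrix.mul_apply, Matrix.mulVec, Matrix.transpose_apply]
    exact Finset.sum_congr rfl fun k _ => by
      congr 1
      exact Finset.sum_congr rfl fun l _ => mul_comm _ _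
  calc ∑ j, (A.updateRow j (M *ᵥ A j)).det = (A * Mᵀ * A.adjugate).trace :=
        Finset.sum_congr rfl fun j _ => h j
    _ = (A.adjugate * A * Mᵀ).trace := by rw [Matrix.trace_mul_comm, Matrix.mul_assoc]
    _ = M.trace * A.det := by
        rw [Matrix.adjugate_mul, Matrix.smul_mul, Matrix.one_mul, Matrix.trace_smul,
          Matrix.trace_transpose, smul_eq_mul, mul_comm]

theorem Fin.exists_perm_succAbove_of_injective {m : ℕ} {v : Fin m → Fin (m + 1)}
    (hv : Function.Injective v) :
    ∃ (i : Fin (m + 1)) (σ : Equiv.Perm (Fin m)), ∀ j, v j = i.succAbove (σ j) := by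
  have hs : ¬ Function.Surjective v := fun h => by
    have := Fintype.card_le_of_surjective v h
    simp at this
  simp only [Function.Surjective, not_forall, not_exists] at hs
  obtain ⟨i, hi⟩ := hs
  choose σ hσ using fun j => Fin.exists_succAbove_eq (hi j)
  have hinj : Function.Injective σ := fun a b hab => hv (by rw [← hσ a, ← hσ b, hab])
  exact ⟨i, Equiv.ofBijective σ (Finite.injective_iff_bijective.mp hinj), fun j => (hσ j).symm⟩

theorem Matrix.det_vecCons_single_succAbove {R : Type*} [CommRing R] {m : ℕ}
    (y : Fin (m + 1) → R) (i : Fin (m + 1)) :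
    (Matrix.of (Matrix.vecCons y fun j => Pi.single (i.succAbove j) (1 : R))).det =
      (-1) ^ (i : ℕ) * y i := by
  rw [Matrix.det_succ_row_zero, Finset.sum_eq_single i]
  · have : (Matrix.of (Matrix.vecCons y fun j => Pi.single (i.succAbove j) (1 : R))).submatrix
        Fin.succ i.succAbove = 1 := by
      ext a b
      simp [Matrix.one_apply, Pi.single_apply, eq_comm]
    rw [this]
    simp
  · intro k _ hk
    obtain ⟨a, ha⟩ := Fin.exists_succAbove_eq hk
    rw [Matrix.det_eq_zero_of_row_eq_zero a, mul_zero]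
    intro b
    simp [ha, Pi.single_apply, Fin.succAbove_ne]
  · simp

/-- The bracket of `A_n` is the generalized cross product. -/
theorem dotProduct_bracket_eq_det {m : ℕ}
    (bracket : AlternatingMap ℂ (Fin (m + 1) → ℂ) (Fin (m + 1) → ℂ) (Fin m))
    (hbr : ∀ i : Fin (m + 1),
      bracket (fun j => Pi.single (i.succAbove j) (1 : ℂ)) =
        ((-1 : ℂ) ^ ((m + 1) + ((i : ℕ) + 1))) • (Pi.single i (1 : ℂ) : Fin (m + 1) → ℂ))
    (y : Fin (m + 1) → ℂ) (x : Fin m → Fin (m + 1) → ℂ) :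
    y ⬝ᵥ bracket x = (-1) ^ m * (Matrix.of (Matrix.vecCons y x)).det := by
  have key : (dotProductBilin ℂ ℂ y).compAlternatingMap bracket =
      ((-1 : ℂ) ^ m) • (Matrix.detRowAlternating (n := Fin (m + 1)) (R := ℂ)).curryLeft y := by
    refine Module.Basis.ext_alternating (Pi.basisFun ℂ (Fin (m + 1))) fun v hv => ?_
    obtain ⟨i, σ, hσ⟩ := Fin.exists_perm_succAbove_of_injective hv
    have hx : (fun j => Pi.basisFun ℂ (Fin (m + 1)) (v j)) =
        (fun j => Pi.single (i.succAbove j) (1 : ℂ)) ∘ σ := by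
      funext j
      simp [hσ]
    rw [hx, AlternatingMap.map_perm, AlternatingMap.map_perm]
    congr 1
    have h := Matrix.det_vecCons_single_succAbove y i
    rw [AlternatingMap.smul_apply, AlternatingMap.curryLeft_apply_apply,
      LinearMap.compAlternatingMap_apply, hbr]
    change y ⬝ᵥ _ = (-1 : ℂ) ^ m *
      (Matrix.of (Matrix.vecCons y fun j => Pi.single (i.succAbove j) (1 : ℂ))).det
    rw [h, dotProduct_smul, dotProduct_single, smul_eq_mul]
    ring
  exact congrArg (fun f => f x) key

theorem dotProduct_sum_bracket_update {m : ℕ}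
    (bracket : AlternatingMap ℂ (Fin (m + 1) → ℂ) (Fin (m + 1) → ℂ) (Fin m))
    (hbr : ∀ i : Fin (m + 1),
      bracket (fun j => Pi.single (i.succAbove j) (1 : ℂ)) =
        ((-1 : ℂ) ^ ((m + 1) + ((i : ℕ) + 1))) • (Pi.single i (1 : ℂ) : Fin (m + 1) → ℂ))
    (M : Matrix (Fin (m + 1)) (Fin (m + 1)) ℂ)
    (y : Fin (m + 1) → ℂ) (x : Fin m → Fin (m + 1) → ℂ) :
    y ⬝ᵥ ∑ j, bracket (Function.update x j (M *ᵥ x j)) =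
      M.trace * (y ⬝ᵥ bracket x) - (M *ᵥ y) ⬝ᵥ bracket x := by
  have h := Matrix.sum_det_updateRow_mulVec (Matrix.of (Matrix.vecCons y x)) M
  have h0 : (Matrix.of (Matrix.vecCons y x)).updateRow 0 (M *ᵥ Matrix.of (Matrix.vecCons y x) 0) =
      Matrix.of (Matrix.vecCons (M *ᵥ y) x) :=
    Fin.update_cons_zero (α := fun _ => Fin (m + 1) → ℂ) y x (M *ᵥ y)
  have hs : ∀ j : Fin m, (Matrix.of (Matrix.vecCons y x)).updateRow j.succ
      (M *ᵥ Matrix.of (Matrix.vecCons y x) j.succ) =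
      Matrix.of (Matrix.vecCons y (Function.update x j (M *ᵥ x j))) := fun j =>
    (Fin.cons_update (α := fun _ => Fin (m + 1) → ℂ) y x j (M *ᵥ x j)).symm
  rw [Fin.sum_univ_succ, h0] at h
  simp only [hs] at h
  simp only [dotProduct_sum, dotProduct_bracket_eq_det bracket hbr, ← Finset.mul_sum]
  linear_combination (-1 : ℂ) ^ m * h


/-- For `n = m + 1 ≥ 4`, a linear map `D : ℂ^n → ℂ^n` is a derivation of the
`(n-1)`-ary Filippov algebra `A_n` (whose alternating bracket satisfies
`[e_1, …, ê_i, …, e_n] = (-1)^(n+i) e_i`, indices `1`-based) if and only if its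
matrix in the standard basis is antisymmetric. -/
theorem derivation_iff_antisymmetric
    (m : ℕ) (hm : 3 ≤ m)
    (bracket : AlternatingMap ℂ (Fin (m + 1) → ℂ) (Fin (m + 1) → ℂ) (Fin m))
    (hbr : ∀ i : Fin (m + 1),
      bracket (fun j => Pi.single (i.succAbove j) (1 : ℂ)) =
        ((-1 : ℂ) ^ ((m + 1) + ((i : ℕ) + 1))) • (Pi.single i (1 : ℂ) : Fin (m + 1) → ℂ))
    (D : (Fin (m + 1) → ℂ) →ₗ[ℂ] (Fin (m + 1) → ℂ)) :
    (∀ x : Fin m → (Fin (m + 1) → ℂ),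
        D (bracket x) = ∑ j : Fin m, bracket (Function.update x j (D (x j)))) ↔
      ((∀ s, LinearMap.toMatrix' D s s = 0) ∧
        ∀ s t, s ≠ t → LinearMap.toMatrix' D s t + LinearMap.toMatrix' D t s = 0) := by
  set M := LinearMap.toMatrix' D with hM
  have hD : ∀ v, D v = M *ᵥ v := fun v => (LinearMap.toMatrix'_mulVec D v).symm
  simp only [hD]
  constructor
  · intro h
    have hst : ∀ s t, M s t = M.trace * (1 : Matrix _ _ ℂ) s t - M t s := by
      intro s t
      have h1 := dotProduct_sum_bracket_update bracket hbr M (Pi.single s 1)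
        (fun j => Pi.single (t.succAbove j) (1 : ℂ))
      rw [← h, hbr] at h1
      have hc : ((-1 : ℂ) ^ ((m + 1) + ((t : ℕ) + 1))) ≠ 0 := by simp
      apply mul_left_cancel₀ hc
      simp [Matrix.mulVec_smul] at h1
      rw [Matrix.one_apply]
      simp only [Pi.single_apply, eq_comm (a := t)] at h1
      linear_combination h1
    have htr : M.trace = 0 := by
      have h2 : M.trace = M.trace * (m + 1) - M.trace := by
        conv_lhs => rw [Matrix.trace]
        simp only [Matrix.diag_apply]
        rw [Finset.sum_congr rfl fun s _ => hst s s]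
        simp [Matrix.trace, Finset.sum_sub_distrib]
        ring
      have hm1 : (m : ℂ) - 1 ≠ 0 := by
        rw [sub_ne_zero]
        exact_mod_cast (by omega : m ≠ 1)
      apply mul_left_cancel₀ hm1
      linear_combination -h2
    simp only [htr, zero_mul, zero_sub] at hst
    exact ⟨fun s => self_eq_neg.mp (hst s s), fun s t _ => by rw [hst s t, neg_add_cancel]⟩
  · rintro ⟨hdiag, hoff⟩ x
    have hT : Mᵀ = -M := by
      ext s t
      by_cases hst : s = t
      · simp [hst, hdiag]
      · exact eq_neg_of_add_eq_zero_right (hoff s t hst)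
    have htr : M.trace = 0 := Finset.sum_eq_zero fun s _ => hdiag s
    refine dotProduct_eq _ _ fun y => ?_
    rw [dotProduct_comm, dotProduct_comm _ y, dotProduct_sum_bracket_update bracket hbr, htr,
      Matrix.dotProduct_mulVec, ← Matrix.mulVec_transpose, hT, Matrix.neg_mulVec, neg_dotProduct]
    ring
end

section
/- Let n ≥ 4. Every 2-local derivation Δ of the (n−1)-ary algebra A_n is a derivation of A_n; in particular, Δ is ℂ-linear. -/
open Matrix in
/-- Applying an endomorphism `D` to one row at a time multiplies the determinant by `trace D`. -/
theorem sum_det_update_eq_trace_mul_det {R ι : Type*} [CommRing R] [Fintype ι] [DecidableEq ι]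
    (D : (ι → R) →ₗ[R] (ι → R)) (x : ι → ι → R) :
    ∑ j, detRowAlternating (Function.update x j (D (x j))) =
      (LinearMap.toMatrix' D).trace * detRowAlternating x := by
  set M := LinearMap.toMatrix' D
  set X : Matrix ι ι R := Matrix.of x
  have hrow (j : ι) : D (x j) = (X * Mᵀ) j := by
    rw [← LinearMap.toMatrix'_mulVec D (x j)]
    ext k
    simp [Matrix.mulVec, dotProduct, Matrix.mul_apply, X, M, mul_comm]
  have hdet (j : ι) : detRowAlternating (Function.update x j (D (x j))) =
      (X * Mᵀ * adjugate X) j j := by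
    change (X.updateRow j (D (x j))).det = _
    rw [← cramer_transpose_apply, cramer_eq_adjugate_mulVec, ← adjugate_transpose, hrow]
    simp [Matrix.mulVec, dotProduct, Matrix.mul_apply (M := X * Mᵀ), mul_comm]
  simp_rw [hdet]
  change (X * Mᵀ * adjugate X).trace = M.trace * X.det
  rw [mul_assoc, trace_mul_comm, mul_assoc, adjugate_mul]
  simp [mul_comm]

/-- The first-row expansion of the determinant whose other rows are the standard basis vectors
with `e_i` omitted. -/
theorem detRowAlternating_cons_single_succAbove {m : ℕ} (k i : Fin (m + 1)) :
    (Matrix.detRowAlternating (R := ℂ)).curryLeft (Pi.single k 1)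
      (fun j => Pi.single (i.succAbove j) (1 : ℂ)) = if k = i then (-1) ^ (i : ℕ) else 0 := by
  split_ifs with h
  · subst h
    change Matrix.det (Matrix.of (Fin.cons (Pi.single k 1)
      (fun j => Pi.single (k.succAbove j) (1 : ℂ)))) = _
    rw [Matrix.det_succ_row_zero, Finset.sum_eq_single k]
    · have : (Matrix.of (Fin.cons (Pi.single k 1)
          (fun j => Pi.single (k.succAbove j) (1 : ℂ)))).submatrix Fin.succ k.succAbove =
          (1 : Matrix (Fin m) (Fin m) ℂ) := by
        ext a b
        simp [Matrix.one_apply, Pi.single_apply, eq_comm]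
      rw [this]
      simp
    · intro b _ hb
      simp [hb]
    · simp
  · obtain ⟨j, rfl⟩ := Fin.exists_succAbove_eq h
    rw [AlternatingMap.curryLeft_apply_apply]
    exact AlternatingMap.map_eq_zero_of_eq _ _ (i := 0) (j := j.succ) (by simp)
      (Fin.succ_ne_zero j).symm

/-- An injection `Fin m → Fin (m + 1)` is, up to a permutation, the map skipping one value. -/
theorem Fin.exists_eq_succAbove_comp_perm {m : ℕ} {v : Fin m → Fin (m + 1)}
    (hv : Function.Injective v) :
    ∃ (i : Fin (m + 1)) (σ : Equiv.Perm (Fin m)), v = i.succAbove ∘ σ := by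
  obtain ⟨i, hi⟩ : ∃ i, ∀ j, v j ≠ i := by
    by_contra! h
    have := Fintype.card_le_of_surjective v h
    simp at this
  choose f hf using fun j => Fin.exists_succAbove_eq (hi j)
  have hinj : Function.Injective f := fun a b hab => hv (by rw [← hf a, ← hf b, hab])
  exact ⟨i, Equiv.ofBijective f (Finite.injective_iff_bijective.mp hinj),
    funext fun j => (hf j).symm⟩

section FilippovAlgebra

variable {m : ℕ} {bracket : AlternatingMap ℂ (Fin (m + 1) → ℂ) (Fin (m + 1) → ℂ) (Fin m)}

/-- The bracket of `A_n` is the generalized cross product. -/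
theorem bracket_dotProduct_eq_det
    (hbr : ∀ i : Fin (m + 1),
      bracket (fun j => Pi.single (i.succAbove j) (1 : ℂ)) =
        ((-1 : ℂ) ^ ((m + 1) + ((i : ℕ) + 1))) • (Pi.single i (1 : ℂ) : Fin (m + 1) → ℂ))
    (x : Fin m → Fin (m + 1) → ℂ) (y : Fin (m + 1) → ℂ) :
    bracket x ⬝ᵥ y = (-1) ^ m * Matrix.detRowAlternating (Fin.cons y x : Fin (m + 1) → _) := by
  have hcoord (k : Fin (m + 1)) :
      (LinearMap.proj (R := ℂ) (φ := fun _ : Fin (m + 1) => ℂ) k).compAlternatingMap bracket =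
        (-1 : ℂ) ^ m • (Matrix.detRowAlternating (R := ℂ)).curryLeft (Pi.single k 1) := by
    refine Module.Basis.ext_alternating (Pi.basisFun ℂ (Fin (m + 1))) fun v hv => ?_
    obtain ⟨i, σ, rfl⟩ := Fin.exists_eq_succAbove_comp_perm hv
    have hcomp : (fun j => Pi.basisFun ℂ (Fin (m + 1)) ((i.succAbove ∘ σ) j)) =
        (fun j => Pi.single (i.succAbove j) (1 : ℂ)) ∘ σ := by
      ext j
      simp
    rw [hcomp, AlternatingMap.map_perm, AlternatingMap.map_perm]
    congr 1
    rw [LinearMap.compAlternatingMap_apply, hbr, AlternatingMap.smul_apply,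
      detRowAlternating_cons_single_succAbove]
    by_cases h : k = i
    · simp [h, pow_add]
    · simp [h]
  have hlin : Matrix.detRowAlternating (Fin.cons y x : Fin (m + 1) → _) =
      ∑ k, y k * (Matrix.detRowAlternating (R := ℂ)).curryLeft (Pi.single k 1) x := by
    let φ : (Fin (m + 1) → ℂ) →ₗ[ℂ] ℂ :=
      { toFun := fun z => (Matrix.detRowAlternating (R := ℂ)).curryLeft z x
        map_add' := fun z w => by rw [map_add, AlternatingMap.add_apply]
        map_smul' := fun c z => by rw [map_smul, AlternatingMap.smul_apply, RingHom.id_apply] }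
    change φ y = ∑ k, y k * φ (Pi.single k 1)
    conv_lhs => rw [pi_eq_sum_univ' y]
    simp only [map_sum, map_smul, smul_eq_mul]
  rw [hlin, dotProduct, Finset.mul_sum]
  refine Finset.sum_congr rfl fun k _ => ?_
  have := DFunLike.congr_fun (hcoord k) x
  simp only [LinearMap.compAlternatingMap_apply, LinearMap.proj_apply, AlternatingMap.smul_apply,
    smul_eq_mul] at this
  rw [this]
  ring

theorem sum_bracket_update_dotProduct_add
    (hbr : ∀ i : Fin (m + 1),
      bracket (fun j => Pi.single (i.succAbove j) (1 : ℂ)) =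
        ((-1 : ℂ) ^ ((m + 1) + ((i : ℕ) + 1))) • (Pi.single i (1 : ℂ) : Fin (m + 1) → ℂ))
    (D : (Fin (m + 1) → ℂ) →ₗ[ℂ] (Fin (m + 1) → ℂ))
    (x : Fin m → Fin (m + 1) → ℂ) (y : Fin (m + 1) → ℂ) :
    (∑ j, bracket (Function.update x j (D (x j)))) ⬝ᵥ y + bracket x ⬝ᵥ D y =
      (LinearMap.toMatrix' D).trace * (bracket x ⬝ᵥ y) := by
  have h := sum_det_update_eq_trace_mul_det D (Fin.cons y x : Fin (m + 1) → Fin (m + 1) → ℂ)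
  rw [Fin.sum_univ_succ] at h
  simp only [Fin.cons_zero, Fin.cons_succ, Fin.update_cons_zero, ← Fin.cons_update] at h
  rw [sum_dotProduct]
  simp only [bracket_dotProduct_eq_det hbr, ← Finset.mul_sum]
  linear_combination (-1) ^ m * h

theorem trace_toMatrix'_eq_sum_dotProduct (D : (Fin (m + 1) → ℂ) →ₗ[ℂ] (Fin (m + 1) → ℂ)) :
    (LinearMap.toMatrix' D).trace = ∑ i, D (Pi.single i 1) ⬝ᵥ Pi.single i 1 := by
  simp [Matrix.trace, LinearMap.toMatrix'_apply]

/-- Derivations of `A_n` are skew-symmetric. -/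
theorem dotProduct_skew_of_derivation (hm : 3 ≤ m)
    (hbr : ∀ i : Fin (m + 1),
      bracket (fun j => Pi.single (i.succAbove j) (1 : ℂ)) =
        ((-1 : ℂ) ^ ((m + 1) + ((i : ℕ) + 1))) • (Pi.single i (1 : ℂ) : Fin (m + 1) → ℂ))
    {D : (Fin (m + 1) → ℂ) →ₗ[ℂ] (Fin (m + 1) → ℂ)}
    (hD : ∀ x : Fin m → (Fin (m + 1) → ℂ),
      D (bracket x) = ∑ j : Fin m, bracket (Function.update x j (D (x j))))
    (u v : Fin (m + 1) → ℂ) : D u ⬝ᵥ v + u ⬝ᵥ D v = 0 := by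
  set t := (LinearMap.toMatrix' D).trace with ht
  have hbasis (i : Fin (m + 1)) (y : Fin (m + 1) → ℂ) :
      D (Pi.single i 1) ⬝ᵥ y + Pi.single i 1 ⬝ᵥ D y = t * (Pi.single i 1 ⬝ᵥ y) := by
    have h := sum_bracket_update_dotProduct_add hbr D (fun j => Pi.single (i.succAbove j) 1) y
    rw [← hD, hbr, map_smul, smul_dotProduct, smul_dotProduct, smul_dotProduct] at h
    simp only [smul_eq_mul] at h
    have h0 : ((-1 : ℂ) ^ ((m + 1) + ((i : ℕ) + 1))) ≠ 0 := pow_ne_zero _ (by norm_num)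
    exact mul_left_cancel₀ h0 (by linear_combination h)
  have hdiag (i : Fin (m + 1)) : 2 * (D (Pi.single i 1) ⬝ᵥ Pi.single i 1) = t := by
    have h := hbasis i (Pi.single i 1)
    rw [dotProduct_comm (Pi.single i 1) (D _)] at h
    simp only [dotProduct_single, Pi.single_eq_same, mul_one] at h ⊢
    linear_combination h
  have ht0 : t = 0 := by
    have h : 2 * t = (m + 1) * t := by
      conv_lhs => rw [ht, trace_toMatrix'_eq_sum_dotProduct, Finset.mul_sum]
      simp only [hdiag]
      simp
    have hne : (m : ℂ) - 1 ≠ 0 := by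
      rw [sub_ne_zero]
      exact_mod_cast (by omega : m ≠ 1)
    exact (mul_eq_zero.mp (by linear_combination -h : ((m : ℂ) - 1) * t = 0)).resolve_left hne
  have hu : D u ⬝ᵥ v + u ⬝ᵥ D v =
      ∑ i, u i * (D (Pi.single i 1) ⬝ᵥ v + Pi.single i 1 ⬝ᵥ D v) := by
    conv_lhs => rw [pi_eq_sum_univ' u]
    simp only [map_sum, map_smul, sum_dotProduct, smul_dotProduct, smul_eq_mul,
      ← Finset.sum_add_distrib, mul_add]
  simp only [hu, hbasis, ht0, zero_mul, mul_zero, Finset.sum_const_zero]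

/-- Skew-symmetric endomorphisms are derivations of `A_n`. -/
theorem derivation_of_dotProduct_skew
    (hbr : ∀ i : Fin (m + 1),
      bracket (fun j => Pi.single (i.succAbove j) (1 : ℂ)) =
        ((-1 : ℂ) ^ ((m + 1) + ((i : ℕ) + 1))) • (Pi.single i (1 : ℂ) : Fin (m + 1) → ℂ))
    {D : (Fin (m + 1) → ℂ) →ₗ[ℂ] (Fin (m + 1) → ℂ)}
    (hD : ∀ u v, D u ⬝ᵥ v + u ⬝ᵥ D v = 0) (x : Fin m → (Fin (m + 1) → ℂ)) :
    D (bracket x) = ∑ j : Fin m, bracket (Function.update x j (D (x j))) := by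
  have ht : (LinearMap.toMatrix' D).trace = 0 := by
    rw [trace_toMatrix'_eq_sum_dotProduct]
    refine Finset.sum_eq_zero fun i _ => ?_
    have h := hD (Pi.single i 1) (Pi.single i 1)
    rw [dotProduct_comm (Pi.single i 1) (D _)] at h
    exact self_eq_neg.mp (eq_neg_of_add_eq_zero_left h)
  refine dotProduct_eq _ _ fun y => ?_
  have h := sum_bracket_update_dotProduct_add hbr D x y
  rw [ht] at h
  linear_combination hD (bracket x) y - h

end FilippovAlgebra

/-- A map that is skew-symmetric for the dot product is linear. -/
theorem exists_linearMap_of_dotProduct_skew {ι : Type*} [Fintype ι] [DecidableEq ι]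
    {R : Type*} [CommRing R] {f : (ι → R) → (ι → R)}
    (hf : ∀ u v, f u ⬝ᵥ v + u ⬝ᵥ f v = 0) : ∃ D : (ι → R) →ₗ[R] (ι → R), ∀ v, f v = D v := by
  have h (u : ι → R) (y : ι → R) : f u ⬝ᵥ y = -(u ⬝ᵥ f y) := eq_neg_of_add_eq_zero_left (hf u y)
  refine ⟨⟨⟨f, fun u v => dotProduct_eq _ _ fun y => ?_⟩, fun c u => dotProduct_eq _ _ fun y => ?_⟩,
    fun _ => rfl⟩
  · simp only [h, add_dotProduct]
    ring
  · simp [h, smul_dotProduct]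

/-- For `n = m + 1 ≥ 4`, every 2-local derivation `Δ` of the `(n-1)`-ary Filippov
algebra `A_n` is a derivation; in particular, `Δ` is `ℂ`-linear. -/
theorem two_local_derivation_is_derivation_An
    (m : ℕ) (hm : 3 ≤ m)
    (bracket : AlternatingMap ℂ (Fin (m + 1) → ℂ) (Fin (m + 1) → ℂ) (Fin m))
    (hbr : ∀ i : Fin (m + 1),
      bracket (fun j => Pi.single (i.succAbove j) (1 : ℂ)) =
        ((-1 : ℂ) ^ ((m + 1) + ((i : ℕ) + 1))) • (Pi.single i (1 : ℂ) : Fin (m + 1) → ℂ))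
    (Δ : (Fin (m + 1) → ℂ) → (Fin (m + 1) → ℂ))
    (h2loc : ∀ u v : Fin (m + 1) → ℂ, ∃ D : (Fin (m + 1) → ℂ) →ₗ[ℂ] (Fin (m + 1) → ℂ),
      (∀ x : Fin m → (Fin (m + 1) → ℂ),
        D (bracket x) = ∑ j : Fin m, bracket (Function.update x j (D (x j)))) ∧
      Δ u = D u ∧ Δ v = D v) :
    ∃ D : (Fin (m + 1) → ℂ) →ₗ[ℂ] (Fin (m + 1) → ℂ),
      (∀ v, Δ v = D v) ∧
      (∀ x : Fin m → (Fin (m + 1) → ℂ),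
        D (bracket x) = ∑ j : Fin m, bracket (Function.update x j (D (x j)))) := by
  have hskew (u v : Fin (m + 1) → ℂ) : Δ u ⬝ᵥ v + u ⬝ᵥ Δ v = 0 := by
    obtain ⟨D, hD, hu, hv⟩ := h2loc u v
    rw [hu, hv]
    exact dotProduct_skew_of_derivation hm hbr hD u v
  obtain ⟨D, hΔ⟩ := exists_linearMap_of_dotProduct_skew hskew
  exact ⟨D, hΔ, derivation_of_dotProduct_skew hbr fun u v => by rw [← hΔ, ← hΔ, hskew]⟩
end

section
/- Let Φ : O → O be a unital ℂ-algebra automorphism of the octonion algebra O (a ℂ-linear bijection with Φ(1) = 1 and Φ(xy) = Φ(x)Φ(y) for all x, y). Then Φ commutes with the conjugation, preserves the bilinear form ⟨·,·⟩, and preserves the ternary Malcev product: Φ([x,y,z]) = [Φ(x),Φ(y),Φ(z)] for all x, y, z ∈ O. -/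
noncomputable section

/-- The complex octonions, realized by the Cayley–Dickson construction as
pairs of complex quaternions. -/
abbrev Oct : Type := Quaternion ℂ × Quaternion ℂ

namespace Oct

/-- Octonion multiplication: `(p,q)(r,s) = (pr − s̄q, sp + qr̄)`. -/
def mul (x y : Oct) : Oct :=
  (x.1 * y.1 - star y.2 * x.2, y.2 * x.1 + x.2 * star y.1)

/-- Octonion conjugation: `(p,q) ↦ (p̄, −q)`. -/
def conj (x : Oct) : Oct := (star x.1, -x.2)

/-- The octonion unit `1 = (1,0)`. -/
def one : Oct := (1, 0)

/-- The symmetric bilinear form `⟨·,·⟩` on the octonions, defined by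
`x ȳ + y x̄ = 2 ⟨x,y⟩ · 1` (the left-hand side always lies in `ℂ·1`). -/
def form (x y : Oct) : ℂ := ((mul x (conj y) + mul y (conj x)).1).re / 2

/-- The ternary Malcev product on `M₈`:
`[x,y,z] = (x ȳ) z − ⟨y,z⟩ x + ⟨x,z⟩ y − ⟨x,y⟩ z`. -/
def tmul (x y z : Oct) : Oct :=
  mul (mul x (conj y)) z - form y z • x + form x z • y - form x y • z

/-- A derivation of the ternary Malcev algebra `M₈`. -/
def IsDer (D : Oct →ₗ[ℂ] Oct) : Prop :=
  ∀ x y z : Oct, D (tmul x y z) = tmul (D x) y z + tmul x (D y) z + tmul x y (D z)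

/-- A local derivation of the ternary Malcev algebra `M₈`. -/
def IsLocDer (T : Oct →ₗ[ℂ] Oct) : Prop :=
  ∀ x : Oct, ∃ D : Oct →ₗ[ℂ] Oct, IsDer D ∧ T x = D x

end Oct

namespace Oct

/-- The real part of an octonion, i.e. half its trace. -/
def re (x : Oct) : ℂ := x.1.re

theorem one_fst_components :
    one.1.re = 1 ∧ one.1.imI = 0 ∧ one.1.imJ = 0 ∧ one.1.imK = 0 := ⟨rfl, rfl, rfl, rfl⟩

theorem one_snd_components :
    one.2.re = 0 ∧ one.2.imI = 0 ∧ one.2.imJ = 0 ∧ one.2.imK = 0 := ⟨rfl, rfl, rfl, rfl⟩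

theorem re_smul_one (c : ℂ) : re (c • one) = c := mul_one c

theorem conj_eq (x : Oct) : conj x = (2 * re x) • one - x := by
  ext <;> simp [conj, re, one_fst_components, one_snd_components]; ring

theorem mul_self_eq (x : Oct) : mul x x = (2 * re x) • x - form x x • one := by
  ext <;> simp [mul, conj, form, re, one_fst_components, one_snd_components] <;> ring

theorem mul_conj_add_mul_conj (x y : Oct) :
    mul x (conj y) + mul y (conj x) = (2 * form x y) • one := by
  ext <;> simp [mul, conj, form, one_fst_components, one_snd_components] <;> ring

/-- An injective unital multiplicative linear map preserves the real part: comparing the quadratic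
equations of `x` and `Φ x` shows that otherwise `Φ x`, hence `x`, is a scalar. -/
theorem re_map {Φ : Oct →ₗ[ℂ] Oct} (hinj : Function.Injective Φ) (h1 : Φ one = one)
    (hmul : ∀ x y : Oct, Φ (mul x y) = mul (Φ x) (Φ y)) (x : Oct) :
    re (Φ x) = re x := by
  by_contra hne
  have hd : 2 * re (Φ x) - 2 * re x ≠ 0 := by
    rw [← mul_sub]
    exact mul_ne_zero two_ne_zero (sub_ne_zero.mpr hne)
  have hquad : (2 * re x) • Φ x - form x x • one =
      (2 * re (Φ x)) • Φ x - form (Φ x) (Φ x) • one := by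
    rw [← mul_self_eq, ← hmul, mul_self_eq x, map_sub, map_smul, map_smul, h1]
  have hscalar : (2 * re (Φ x) - 2 * re x) • Φ x = (form (Φ x) (Φ x) - form x x) • one := by
    linear_combination (norm := module) (-1 : ℂ) • hquad
  obtain ⟨c, hc⟩ : ∃ c : ℂ, Φ x = c • one :=
    ⟨(2 * re (Φ x) - 2 * re x)⁻¹ * (form (Φ x) (Φ x) - form x x), by
      rw [mul_smul, ← hscalar, inv_smul_smul₀ hd]⟩
  have hx : x = c • one := hinj (by rw [hc, map_smul, h1])
  exact hne (by rw [hc, ← hx])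

end Oct

open Oct in
/-- Every unital `ℂ`-algebra automorphism of the octonions commutes with
conjugation, preserves the bilinear form, and preserves the ternary Malcev
product of `M₈`. -/
theorem automorphism_preserves_conj_form_tmul
    (Φ : Oct →ₗ[ℂ] Oct) (hbij : Function.Bijective Φ)
    (h1 : Φ one = one) (hmul : ∀ x y : Oct, Φ (mul x y) = mul (Φ x) (Φ y)) :
    (∀ x : Oct, Φ (conj x) = conj (Φ x)) ∧
    (∀ x y : Oct, form (Φ x) (Φ y) = form x y) ∧
    (∀ x y z : Oct, Φ (tmul x y z) = tmul (Φ x) (Φ y) (Φ z)) := by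
  have hconj (x : Oct) : Φ (conj x) = conj (Φ x) := by
    rw [conj_eq, conj_eq, map_sub, map_smul, h1, re_map hbij.injective h1 hmul]
  have hform (x y : Oct) : form (Φ x) (Φ y) = form x y := by
    refine mul_left_cancel₀ (two_ne_zero (α := ℂ)) ?_
    rw [← re_smul_one (2 * form (Φ x) (Φ y)), ← mul_conj_add_mul_conj, ← hconj, ← hconj,
      ← hmul, ← hmul, ← map_add, mul_conj_add_mul_conj, map_smul, h1, re_smul_one]
  refine ⟨hconj, hform, fun x y z => ?_⟩
  simp only [tmul, map_sub, map_add, map_smul, hmul, hconj, hform]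
end
end

section
/- Let x, y ∈ O be elements not lying in ℂ·1 such that x² = −1, y² = −1, and ⟨x,y⟩ = 0. Then there exists a unital ℂ-algebra automorphism Φ of O with Φ(e_2) = x and Φ(e_3) = y; in particular, Φ is an automorphism of the ternary Malcev algebra M_8, i.e., Φ([u,v,w]) = [Φ(u),Φ(v),Φ(w)] for all u, v, w ∈ O. -/
noncomputable section

namespace Oct

section

open scoped Quaternion

lemma zero_smul (a : Oct) : (0 : ℂ) • a = 0 := _root_.zero_smul ℂ a

lemma one_smul (a : Oct) : (1 : ℂ) • a = a := _root_.one_smul ℂ a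

lemma neg_one_smul (a : Oct) : (-1 : ℂ) • a = -a := _root_.neg_one_smul ℂ a

lemma sub_smul (s t : ℂ) (a : Oct) : (s - t) • a = s • a - t • a := _root_.sub_smul s t a

lemma smul_smul (s t : ℂ) (a : Oct) : s • t • a = (s * t) • a := _root_.smul_smul s t a

lemma add_mul (a b c : Oct) : mul (a + b) c = mul a c + mul b c := by
  ext <;> simp [mul] <;> ring

lemma mul_add (a b c : Oct) : mul a (b + c) = mul a b + mul a c := by
  ext <;> simp [mul] <;> ring

lemma smul_mul (t : ℂ) (a b : Oct) : mul (t • a) b = t • mul a b := by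
  ext <;> simp [mul] <;> ring

lemma mul_smul (t : ℂ) (a b : Oct) : mul a (t • b) = t • mul a b := by
  ext <;> simp [mul] <;> ring

lemma neg_mul (a b : Oct) : mul (-a) b = -mul a b := by
  ext <;> simp [mul] <;> ring

lemma mul_neg (a b : Oct) : mul a (-b) = -mul a b := by
  ext <;> simp [mul] <;> ring

lemma one_mul (a : Oct) : mul one a = a := by
  ext <;> simp [mul, one]

lemma mul_one (a : Oct) : mul a one = a := by
  ext <;> simp [mul, one]

lemma conj_add (a b : Oct) : conj (a + b) = conj a + conj b := by
  ext <;> simp [conj] <;> ring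

lemma conj_smul (t : ℂ) (a : Oct) : conj (t • a) = t • conj a := by
  ext <;> simp [conj]

lemma conj_one : conj one = one := by
  ext <;> simp [conj, one]

lemma conj_mul (a b : Oct) : conj (mul a b) = mul (conj b) (conj a) := by
  ext <;> simp [conj, mul] <;> ring

lemma form_eq (a b : Oct) : form a b =
    a.1.re * b.1.re + a.1.imI * b.1.imI + a.1.imJ * b.1.imJ + a.1.imK * b.1.imK +
    a.2.re * b.2.re + a.2.imI * b.2.imI + a.2.imJ * b.2.imJ + a.2.imK * b.2.imK := by
  simp [form, mul, conj]
  ring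

lemma form_comm (a b : Oct) : form a b = form b a := by
  simp only [form_eq]
  ring

lemma form_add_left (a b c : Oct) : form (a + b) c = form a c + form b c := by
  simp [form_eq]
  ring

lemma form_smul_left (t : ℂ) (a b : Oct) : form (t • a) b = t * form a b := by
  simp [form_eq]
  ring

lemma form_add_right (a b c : Oct) : form a (b + c) = form a b + form a c := by
  simp [form_eq]
  ring

lemma form_smul_right (t : ℂ) (a b : Oct) : form a (t • b) = t * form a b := by
  simp [form_eq]
  ring

lemma form_one_one : form one one = 1 := by
  simp [form_eq, one]

lemma form_mul_left (a b c : Oct) : form (mul a b) c = form b (mul (conj a) c) := by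
  simp [form_eq, mul, conj]
  ring

lemma form_mul_right (a b c : Oct) : form (mul a b) c = form a (mul c (conj b)) := by
  simp [form_eq, mul, conj]
  ring

lemma mul_conj_add (a b : Oct) :
    mul a (conj b) + mul b (conj a) = (2 * form a b) • one := by
  ext <;> simp [form_eq, mul, conj, one] <;> ring

set_option maxHeartbeats 1000000 in
/-- The linearized left alternative law. -/
lemma mul_conj_mul_add (a b c : Oct) :
    mul a (mul (conj b) c) + mul b (mul (conj a) c) = (2 * form a b) • c := by
  ext <;> simp [form_eq, mul, conj] <;> ring

set_option maxHeartbeats 1000000 in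
/-- The linearized right alternative law. -/
lemma mul_mul_conj_add (a b c : Oct) :
    mul (mul c (conj a)) b + mul (mul c (conj b)) a = (2 * form a b) • c := by
  ext <;> simp [form_eq, mul, conj] <;> ring

lemma add_conj (a : Oct) : a + conj a = (2 * form a one) • one := by
  ext <;> simp [form_eq, conj, one]
  ring

lemma mul_conj_self (a : Oct) : mul a (conj a) = form a a • one := by
  linear_combination (norm := module) (1 / 2 : ℂ) • mul_conj_add a a

end

lemma form_one_eq_zero_and_form_self_eq_one {x : Oct}
    (hx1 : x ∉ Submodule.span ℂ ({one} : Set Oct)) (hx : mul x x = -one) :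
    form x one = 0 ∧ form x x = 1 := by
  have h : (2 * form x one) • x = (form x x - 1) • one := by
    have h1 := mul_conj_self x
    rw [eq_sub_of_add_eq' (add_conj x), sub_eq_add_neg, mul_add, mul_smul, mul_one, mul_neg,
      hx, neg_neg] at h1
    rw [sub_smul, ← h1]
    module
  have h0 : form x one = 0 := by
    by_contra h0
    refine hx1 (Submodule.mem_span_singleton.2 ⟨(2 * form x one)⁻¹ * (form x x - 1), ?_⟩)
    rw [← smul_smul, ← h, smul_smul, inv_mul_cancel₀ (by simpa using h0), one_smul]
  refine ⟨h0, ?_⟩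
  have := congrArg (form one) h
  simp only [form_smul_right, form_comm one x, h0, form_one_one] at this
  linear_combination -this

lemma conj_of_form_one_eq_zero {x : Oct} (h : form x one = 0) : conj x = -x := by
  have := add_conj x
  rw [h] at this
  simp only [mul_zero, zero_smul] at this
  exact (neg_eq_of_add_eq_zero_right this).symm

/-- The linear map `ℍ → O` sending the standard basis to `1, x, y, xy`. -/
def quatMap (x y : Oct) : Quaternion ℂ →ₗ[ℂ] Oct where
  toFun p := p.re • one + p.imI • x + p.imJ • y + p.imK • mul x y
  map_add' p q := by simp only [Quaternion.re_add, Quaternion.imI_add, Quaternion.imJ_add,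
    Quaternion.imK_add]; module
  map_smul' t p := by simp only [Quaternion.re_smul, Quaternion.imI_smul, Quaternion.imJ_smul,
    Quaternion.imK_smul, smul_eq_mul, RingHom.id_apply]; module

open scoped Quaternion in
lemma quatMap_one (x y : Oct) : quatMap x y 1 = one := by
  change (1 : Quaternion ℂ).re • one + (1 : Quaternion ℂ).imI • x + (1 : Quaternion ℂ).imJ • y +
    (1 : Quaternion ℂ).imK • mul x y = one
  rw [Quaternion.re_one, Quaternion.imI_one, Quaternion.imJ_one, Quaternion.imK_one]
  module

lemma quatMap_apply (x y : Oct) (p : Quaternion ℂ) :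
    quatMap x y p = p.re • one + p.imI • x + p.imJ • y + p.imK • mul x y := rfl

/-- The imaginary units `x, y` are orthonormal and orthogonal to `1`. -/
structure IsImPair (x y : Oct) : Prop where
  x_one : form x one = 0
  y_one : form y one = 0
  x_x : form x x = 1
  y_y : form y y = 1
  x_y : form x y = 0

namespace IsImPair

variable {x y : Oct}

lemma conj_x (h : IsImPair x y) : conj x = -x := conj_of_form_one_eq_zero h.x_one

lemma conj_y (h : IsImPair x y) : conj y = -y := conj_of_form_one_eq_zero h.y_one

lemma mul_x_x (h : IsImPair x y) : mul x x = -one := by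
  have := mul_conj_self x
  rw [h.conj_x, mul_neg, h.x_x, one_smul] at this
  rw [← this, neg_neg]

lemma mul_y_y (h : IsImPair x y) : mul y y = -one := by
  have := mul_conj_self y
  rw [h.conj_y, mul_neg, h.y_y, one_smul] at this
  rw [← this, neg_neg]

lemma mul_y_x (h : IsImPair x y) : mul y x = -mul x y := by
  have := mul_conj_add x y
  rw [h.conj_x, h.conj_y, mul_neg, mul_neg, h.x_y] at this
  simp only [mul_zero, zero_smul] at this
  rw [add_eq_zero_iff_eq_neg, neg_neg] at this
  exact this.symm

lemma conj_mul_x_y (h : IsImPair x y) : conj (mul x y) = -mul x y := by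
  rw [conj_mul, h.conj_x, h.conj_y, mul_neg, neg_mul, neg_neg, h.mul_y_x]

lemma mul_x_xy (h : IsImPair x y) : mul x (mul x y) = -y := by
  have := mul_conj_mul_add x x y
  rw [h.conj_x, h.x_x, neg_mul, mul_neg] at this
  linear_combination (norm := module) (-1 / 2 : ℂ) • this

lemma mul_xy_y (h : IsImPair x y) : mul (mul x y) y = -x := by
  have := mul_mul_conj_add y y x
  rw [h.conj_y, h.y_y, mul_neg, neg_mul] at this
  linear_combination (norm := module) (-1 / 2 : ℂ) • this

lemma mul_xy_x (h : IsImPair x y) : mul (mul x y) x = y := by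
  have := mul_mul_conj_add x x y
  rw [h.conj_x, h.x_x, mul_neg, h.mul_y_x, neg_neg] at this
  linear_combination (norm := module) (1 / 2 : ℂ) • this

lemma mul_y_xy (h : IsImPair x y) : mul y (mul x y) = x := by
  have := mul_conj_mul_add y y x
  rw [h.conj_y, h.y_y, neg_mul, h.mul_y_x, neg_neg] at this
  linear_combination (norm := module) (1 / 2 : ℂ) • this

lemma xy_one (h : IsImPair x y) : form (mul x y) one = 0 := by
  rw [form_mul_right, one_mul, h.conj_y, ← neg_one_smul, form_smul_right, h.x_y, mul_zero]

lemma xy_x (h : IsImPair x y) : form (mul x y) x = 0 := by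
  rw [form_mul_left, h.conj_x, neg_mul, h.mul_x_x, neg_neg, h.y_one]

lemma xy_y (h : IsImPair x y) : form (mul x y) y = 0 := by
  rw [form_mul_right, h.conj_y, mul_neg, h.mul_y_y, neg_neg, h.x_one]

lemma xy_xy (h : IsImPair x y) : form (mul x y) (mul x y) = 1 := by
  rw [form_mul_right, h.conj_y, mul_neg, h.mul_xy_y, neg_neg, h.x_x]

lemma mul_xy_xy (h : IsImPair x y) : mul (mul x y) (mul x y) = -one := by
  have := mul_conj_self (mul x y)
  rw [h.conj_mul_x_y, mul_neg, h.xy_xy, one_smul] at this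
  rw [← this, neg_neg]

lemma quatMap_mul (h : IsImPair x y) (p q : Quaternion ℂ) :
    quatMap x y (p * q) = mul (quatMap x y p) (quatMap x y q) := by
  simp only [quatMap_apply, add_mul, mul_add, smul_mul, mul_smul, one_mul, mul_one, h.mul_x_x,
    h.mul_y_y, h.mul_y_x, h.mul_x_xy, h.mul_xy_y, h.mul_xy_x, h.mul_y_xy, h.mul_xy_xy,
    Quaternion.re_mul, Quaternion.imI_mul, Quaternion.imJ_mul, Quaternion.imK_mul]
  module

lemma quatMap_star (h : IsImPair x y) (p : Quaternion ℂ) :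
    quatMap x y (star p) = conj (quatMap x y p) := by
  simp only [quatMap_apply, conj_add, conj_smul, conj_one, h.conj_x, h.conj_y, h.conj_mul_x_y,
    Quaternion.re_star, Quaternion.imI_star, Quaternion.imJ_star, Quaternion.imK_star]
  module

/-- The orthogonal complement of `1, x, y, xy` contains a unit vector. -/
lemma exists_orthogonal_unit (h : IsImPair x y) :
    ∃ u : Oct, form u u = 1 ∧ ∀ p, form (quatMap x y p) u = 0 := by
  let P : Oct → Oct := fun v => v + (-form v one) • one + (-form v x) • x + (-form v y) • y +
    (-form v (mul x y)) • mul x y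
  have hP (v : Oct) (p) : form (quatMap x y p) (P v) = 0 := by
    simp only [P, quatMap_apply, form_add_left, form_smul_left, form_add_right, form_smul_right,
      form_one_one, h.x_one, h.y_one, h.x_x, h.y_y, h.x_y, h.xy_one, h.xy_x, h.xy_y, h.xy_xy,
      form_comm one x, form_comm one y, form_comm y x, form_comm one (mul x y),
      form_comm x (mul x y), form_comm y (mul x y), form_comm v]
    ring
  have hPP (v : Oct) : form (P v) (P v) = form v v - form v one ^ 2 - form v x ^ 2 -
      form v y ^ 2 - form v (mul x y) ^ 2 := by
    simp only [P, form_add_left, form_smul_left, form_add_right, form_smul_right,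
      form_one_one, h.x_one, h.y_one, h.x_x, h.y_y, h.x_y, h.xy_one, h.xy_x, h.xy_y, h.xy_xy,
      form_comm one x, form_comm one y, form_comm y x, form_comm one (mul x y),
      form_comm x (mul x y), form_comm y (mul x y), form_comm _ v]
    ring
  obtain ⟨v, hv⟩ : ∃ v, form (P v) (P v) ≠ 0 := by
    by_contra! hc
    have e1 := (hPP (⟨1, 0, 0, 0⟩, 0)).symm.trans (hc _)
    have e2 := (hPP (⟨0, 1, 0, 0⟩, 0)).symm.trans (hc _)
    have e3 := (hPP (⟨0, 0, 1, 0⟩, 0)).symm.trans (hc _)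
    have e4 := (hPP (⟨0, 0, 0, 1⟩, 0)).symm.trans (hc _)
    have e5 := (hPP (0, ⟨1, 0, 0, 0⟩)).symm.trans (hc _)
    have e6 := (hPP (0, ⟨0, 1, 0, 0⟩)).symm.trans (hc _)
    have e7 := (hPP (0, ⟨0, 0, 1, 0⟩)).symm.trans (hc _)
    have e8 := (hPP (0, ⟨0, 0, 0, 1⟩)).symm.trans (hc _)
    have f1 := form_one_one
    have f2 := h.x_x
    have f3 := h.y_y
    have f4 := h.xy_xy
    generalize mul x y = w at *
    generalize one = o at *
    simp only [form_eq, Quaternion.re_zero, Quaternion.imI_zero, Quaternion.imJ_zero,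
      Quaternion.imK_zero] at e1 e2 e3 e4 e5 e6 e7 e8 f1 f2 f3 f4
    have : (4 : ℂ) = 0 := by
      linear_combination e1 + e2 + e3 + e4 + e5 + e6 + e7 + e8 + f1 + f2 + f3 + f4
    norm_num at this
  obtain ⟨t, ht⟩ := IsAlgClosed.exists_pow_nat_eq (form (P v) (P v)) (n := 2) (by norm_num)
  have ht0 : t ≠ 0 := by
    rintro rfl
    exact hv (by simpa using ht.symm)
  refine ⟨t⁻¹ • P v, ?_, fun p => ?_⟩
  · rw [form_smul_left, form_smul_right, ← ht]
    field_simp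
  · rw [form_smul_right, hP, mul_zero]

end IsImPair

/-- The Cayley–Dickson extension `(p, q) ↦ φ(p) + φ(q) u` of a linear map `φ : ℍ → O`. -/
def doubleMap (φ : Quaternion ℂ →ₗ[ℂ] Oct) (u : Oct) : Oct →ₗ[ℂ] Oct where
  toFun a := φ a.1 + mul (φ a.2) u
  map_add' a b := by
    simp only [Prod.fst_add, Prod.snd_add, map_add, add_mul]
    abel
  map_smul' t a := by
    simp only [Prod.smul_fst, Prod.smul_snd, map_smul, smul_mul, RingHom.id_apply, smul_add]

lemma doubleMap_apply (φ : Quaternion ℂ →ₗ[ℂ] Oct) (u a : Oct) :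
    doubleMap φ u a = φ a.1 + mul (φ a.2) u := rfl

lemma doubleMap_fst (φ : Quaternion ℂ →ₗ[ℂ] Oct) (u : Oct) (p : Quaternion ℂ) :
    doubleMap φ u (p, 0) = φ p := by
  rw [doubleMap_apply, map_zero, ← _root_.zero_smul ℂ (0 : Oct), smul_mul, zero_smul, add_zero]

/-- `φ` is a unital embedding of the quaternions compatible with conjugation, and `u` is a unit
vector orthogonal to its range. -/
structure IsDoubling (φ : Quaternion ℂ →ₗ[ℂ] Oct) (u : Oct) : Prop where
  map_one : φ 1 = one
  map_mul : ∀ p q, φ (p * q) = mul (φ p) (φ q)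
  map_star : ∀ p, φ (star p) = conj (φ p)
  form_self : form u u = 1
  form_map : ∀ p, form (φ p) u = 0

namespace IsDoubling

variable {φ : Quaternion ℂ →ₗ[ℂ] Oct} {u : Oct}

lemma conj_u (h : IsDoubling φ u) : conj u = -u :=
  conj_of_form_one_eq_zero (by rw [form_comm, ← h.map_one, h.form_map])

lemma u_mul (h : IsDoubling φ u) (p : Quaternion ℂ) :
    mul u (φ p) = mul (φ (star p)) u := by
  have := mul_conj_add (φ (star p)) u
  rw [← h.map_star, star_star, h.conj_u, h.form_map, mul_zero, zero_smul, mul_neg] at this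
  exact (neg_add_eq_zero.1 this).symm

lemma u_mul_u_mul (h : IsDoubling φ u) (c : Oct) : mul u (mul u c) = -c := by
  have := mul_conj_mul_add u u c
  rw [h.conj_u, h.form_self, neg_mul, mul_neg] at this
  linear_combination (norm := module) (-1 / 2 : ℂ) • this

lemma mul_mul_u (h : IsDoubling φ u) (p s : Quaternion ℂ) :
    mul (φ p) (mul (φ s) u) = mul (φ (s * p)) u := by
  have := mul_conj_mul_add (φ p) u (φ (star s))
  rw [h.conj_u, ← h.map_star, h.form_map, mul_zero, zero_smul, neg_mul, mul_neg, ← h.map_mul,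
    h.u_mul, h.u_mul, star_mul, star_star, star_star] at this
  exact neg_add_eq_zero.1 this

lemma mul_u_mul (h : IsDoubling φ u) (q r : Quaternion ℂ) :
    mul (mul (φ q) u) (φ r) = mul (φ (q * star r)) u := by
  have := mul_mul_conj_add u (φ r) (φ q)
  rw [h.conj_u, ← h.map_star, form_comm, h.form_map, mul_zero, zero_smul, mul_neg, neg_mul,
    ← h.map_mul] at this
  exact neg_add_eq_zero.1 this

lemma conj_mul_u (h : IsDoubling φ u) (q : Quaternion ℂ) :
    conj (mul (φ q) u) = -mul (φ q) u := by
  rw [conj_mul, h.conj_u, ← h.map_star, neg_mul, h.u_mul, star_star]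

lemma mul_u_mul_mul_u (h : IsDoubling φ u) (q s : Quaternion ℂ) :
    mul (mul (φ q) u) (mul (φ s) u) = -φ (star s * q) := by
  have key := mul_conj_mul_add (mul (φ q) u) u (φ (star s))
  have hform : form (mul (φ q) u) u = form (φ q) one := by
    rw [form_mul_right, mul_conj_self, h.form_self, one_smul]
  have htrace : (2 * form (φ q) one) • φ (star s) = φ (star s * q) + φ (star s * star q) := by
    rw [h.map_mul, h.map_mul, ← mul_add, h.map_star q, add_conj, mul_smul, mul_one]
  have hu : mul u (mul (φ (q * s)) u) = -φ (star s * star q) := by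
    rw [← (star_mul q s : star (q * s) = star s * star q), ← h.u_mul_u_mul, h.u_mul, star_star]
  rw [h.conj_u, h.conj_mul_u, hform, htrace, neg_mul, neg_mul, mul_neg, mul_neg, h.u_mul,
    h.mul_u_mul, star_star, hu] at key
  linear_combination (norm := module) -key

lemma doubleMap_mul (h : IsDoubling φ u) (a b : Oct) :
    doubleMap φ u (mul a b) = mul (doubleMap φ u a) (doubleMap φ u b) := by
  have hab : mul a b = (a.1 * b.1 - star b.2 * a.2, b.2 * a.1 + a.2 * star b.1) := rfl
  simp only [doubleMap_apply, hab, add_mul, mul_add, h.mul_mul_u, h.mul_u_mul,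
    h.mul_u_mul_mul_u, ← h.map_mul, map_add, map_sub]
  abel

lemma doubleMap_one (h : IsDoubling φ u) : doubleMap φ u one = one := by
  rw [one, doubleMap_fst, h.map_one, one]

lemma doubleMap_conj (h : IsDoubling φ u) (a : Oct) :
    doubleMap φ u (conj a) = conj (doubleMap φ u a) := by
  have ha : conj a = (star a.1, -a.2) := rfl
  rw [doubleMap_apply, doubleMap_apply, conj_add, h.conj_mul_u, ← h.map_star, ha, map_neg, neg_mul]

end IsDoubling

section Automorphism

variable {Φ : Oct →ₗ[ℂ] Oct}

lemma form_map_map (h1 : Φ one = one) (hmul : ∀ a b, Φ (mul a b) = mul (Φ a) (Φ b))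
    (hconj : ∀ a, Φ (conj a) = conj (Φ a)) (a b : Oct) : form (Φ a) (Φ b) = form a b := by
  have h := mul_conj_add (Φ a) (Φ b)
  rw [← hconj, ← hconj, ← hmul, ← hmul, ← map_add, mul_conj_add, map_smul, h1] at h
  have := congrArg (form one) h
  rw [form_smul_right, form_smul_right, form_one_one] at this
  linear_combination -this / 2

lemma eq_zero_of_form_eq_zero {a : Oct} (h : ∀ b, form a b = 0) : a = 0 := by
  have h1 := h (⟨1, 0, 0, 0⟩, 0)
  have h2 := h (⟨0, 1, 0, 0⟩, 0)
  have h3 := h (⟨0, 0, 1, 0⟩, 0)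
  have h4 := h (⟨0, 0, 0, 1⟩, 0)
  have h5 := h (0, ⟨1, 0, 0, 0⟩)
  have h6 := h (0, ⟨0, 1, 0, 0⟩)
  have h7 := h (0, ⟨0, 0, 1, 0⟩)
  have h8 := h (0, ⟨0, 0, 0, 1⟩)
  simp only [form_eq, Quaternion.re_zero, Quaternion.imI_zero, Quaternion.imJ_zero,
    Quaternion.imK_zero, mul_zero, _root_.mul_one, add_zero, zero_add] at h1 h2 h3 h4 h5 h6 h7 h8
  exact Prod.ext (QuaternionAlgebra.ext h1 h2 h3 h4) (QuaternionAlgebra.ext h5 h6 h7 h8)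

lemma bijective_of_form_map_map (h : ∀ a b, form (Φ a) (Φ b) = form a b) :
    Function.Bijective Φ := by
  have hinj : Function.Injective Φ := by
    refine (injective_iff_map_eq_zero Φ).2 fun a ha => eq_zero_of_form_eq_zero fun b => ?_
    rw [← h, ha, ← _root_.zero_smul ℂ (0 : Oct), form_smul_left, zero_mul]
  exact ⟨hinj, LinearMap.injective_iff_surjective.1 hinj⟩

lemma map_tmul (hmul : ∀ a b, Φ (mul a b) = mul (Φ a) (Φ b))
    (hconj : ∀ a, Φ (conj a) = conj (Φ a)) (hform : ∀ a b, form (Φ a) (Φ b) = form a b)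
    (u v w : Oct) : Φ (tmul u v w) = tmul (Φ u) (Φ v) (Φ w) := by
  simp only [tmul, map_sub, map_add, map_smul, hmul, hconj, hform]

end Automorphism

end Oct

open Oct in
/-- If `x, y` are octonions not in `ℂ·1` with `x² = y² = -1` and `⟨x,y⟩ = 0`,
then there is a unital `ℂ`-algebra automorphism `Φ` of the octonions with
`Φ e₂ = x` and `Φ e₃ = y`; in particular `Φ` preserves the ternary Malcev
product of `M₈`. -/
theorem exists_automorphism_e2_e3 (x y : Oct)
    (hx1 : x ∉ Submodule.span ℂ ({one} : Set Oct))
    (hy1 : y ∉ Submodule.span ℂ ({one} : Set Oct))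
    (hx : mul x x = -one) (hy : mul y y = -one) (hxy : form x y = 0) :
    ∃ Φ : Oct →ₗ[ℂ] Oct, Function.Bijective Φ ∧ Φ one = one ∧
      (∀ a b : Oct, Φ (mul a b) = mul (Φ a) (Φ b)) ∧
      Φ ((⟨0, 1, 0, 0⟩ : Quaternion ℂ), (0 : Quaternion ℂ)) = x ∧
      Φ ((⟨0, 0, 1, 0⟩ : Quaternion ℂ), (0 : Quaternion ℂ)) = y ∧
      (∀ u v w : Oct, Φ (tmul u v w) = tmul (Φ u) (Φ v) (Φ w)) := by
  obtain ⟨hx0, hxx⟩ := form_one_eq_zero_and_form_self_eq_one hx1 hx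
  obtain ⟨hy0, hyy⟩ := form_one_eq_zero_and_form_self_eq_one hy1 hy
  have hpair : IsImPair x y := ⟨hx0, hy0, hxx, hyy, hxy⟩
  obtain ⟨u, hu, ho⟩ := hpair.exists_orthogonal_unit
  have hd : IsDoubling (quatMap x y) u :=
    ⟨quatMap_one x y, hpair.quatMap_mul, hpair.quatMap_star, hu, ho⟩
  have hform := form_map_map hd.doubleMap_one hd.doubleMap_mul hd.doubleMap_conj
  refine ⟨doubleMap (quatMap x y) u, bijective_of_form_map_map hform, hd.doubleMap_one,
    hd.doubleMap_mul, ?_, ?_, map_tmul hd.doubleMap_mul hd.doubleMap_conj hform⟩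
  · refine (doubleMap_fst _ _ _).trans ((quatMap_apply _ _ _).trans ?_)
    module
  · refine (doubleMap_fst _ _ _).trans ((quatMap_apply _ _ _).trans ?_)
    module
end
end

section
/- The set Der(M_8) of all derivations of the ternary Malcev algebra M_8 is a ℂ-linear subspace of the space of ℂ-linear endomorphisms of O, and its dimension over ℂ equals 21. -/
noncomputable section

/-- The submodules of the endomorphism space of the octonions carry an additive
group structure (made explicit to help instance resolution). -/
noncomputable instance instOctEndSubAddCommGroup (S : Submodule ℂ (Oct →ₗ[ℂ] Oct)) :
    AddCommGroup S :=
  @Submodule.addCommGroup ℂ (Oct →ₗ[ℂ] Oct) Complex.instRing LinearMap.addCommGroup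
    LinearMap.module S

/-- The submodules of the endomorphism space of the octonions carry a `ℂ`-module
structure (made explicit to help instance resolution). -/
noncomputable instance instOctEndSubModule (S : Submodule ℂ (Oct →ₗ[ℂ] Oct)) :
    Module ℂ S :=
  @Submodule.module ℂ (Oct →ₗ[ℂ] Oct) Complex.instSemiring LinearMap.addCommMonoid
    LinearMap.module S

namespace Oct

/-- The coordinates of an octonion in the standard basis. -/
def coords : Oct ≃ₗ[ℂ] (Fin 8 → ℂ) where
  toFun x := ![x.1.re, x.1.imI, x.1.imJ, x.1.imK, x.2.re, x.2.imI, x.2.imJ, x.2.imK]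
  invFun v := (⟨v 0, v 1, v 2, v 3⟩, ⟨v 4, v 5, v 6, v 7⟩)
  map_add' x y := by ext i; fin_cases i <;> rfl
  map_smul' c x := by ext i; fin_cases i <;> simp
  left_inv x := rfl
  right_inv v := by ext i; fin_cases i <;> rfl

theorem coords_apply (x : Oct) : coords x =
    ![x.1.re, x.1.imI, x.1.imJ, x.1.imK, x.2.re, x.2.imI, x.2.imJ, x.2.imK] := rfl

/-- The `3 × 3` minor of the vectors `u, v, w` in the coordinates `i, j, k`. -/
def minor (u v w : Fin 8 → ℂ) (i j k : Fin 8) : ℂ :=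
  u i * (v j * w k - v k * w j) - u j * (v i * w k - v k * w i) + u k * (v i * w j - v j * w i)

/-- The ternary Malcev product in coordinates. -/
def triple (u v w : Fin 8 → ℂ) : Fin 8 → ℂ :=
  ![minor u v w 1 2 3 + minor u v w 1 4 5 - minor u v w 1 6 7 + minor u v w 2 4 6
      + minor u v w 2 5 7 + minor u v w 3 4 7 - minor u v w 3 5 6,
    -minor u v w 0 2 3 - minor u v w 0 4 5 + minor u v w 0 6 7 + minor u v w 2 4 7
      - minor u v w 2 5 6 - minor u v w 3 4 6 - minor u v w 3 5 7,
    minor u v w 0 1 3 - minor u v w 0 4 6 - minor u v w 0 5 7 - minor u v w 1 4 7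
      + minor u v w 1 5 6 + minor u v w 3 4 5 - minor u v w 3 6 7,
    -minor u v w 0 1 2 - minor u v w 0 4 7 + minor u v w 0 5 6 + minor u v w 1 4 6
      + minor u v w 1 5 7 - minor u v w 2 4 5 + minor u v w 2 6 7,
    minor u v w 0 1 5 + minor u v w 0 2 6 + minor u v w 0 3 7 + minor u v w 1 2 7
      - minor u v w 1 3 6 + minor u v w 2 3 5 - minor u v w 5 6 7,
    -minor u v w 0 1 4 + minor u v w 0 2 7 - minor u v w 0 3 6 - minor u v w 1 2 6
      - minor u v w 1 3 7 - minor u v w 2 3 4 + minor u v w 4 6 7,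
    -minor u v w 0 1 7 - minor u v w 0 2 4 + minor u v w 0 3 5 + minor u v w 1 2 5
      + minor u v w 1 3 4 - minor u v w 2 3 7 - minor u v w 4 5 7,
    minor u v w 0 1 6 - minor u v w 0 2 5 - minor u v w 0 3 4 - minor u v w 1 2 4
      + minor u v w 1 3 5 + minor u v w 2 3 6 + minor u v w 4 5 6]

set_option maxHeartbeats 4000000 in
theorem coords_tmul (x y z : Oct) :
    coords (tmul x y z) = triple (coords x) (coords y) (coords z) := by
  ext i
  fin_cases i <;> simp [coords_apply, triple, minor, tmul, form, mul, conj] <;> ring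

theorem tmul_coords_symm (u v w : Fin 8 → ℂ) :
    tmul (coords.symm u) (coords.symm v) (coords.symm w) = coords.symm (triple u v w) := by
  rw [LinearEquiv.eq_symm_apply, coords_tmul]
  simp only [LinearEquiv.apply_symm_apply]

/-- The matrices of the spin representation of `𝔰𝔬(7)` on the octonions, parametrized by
their entries below the diagonal in the imaginary coordinates. -/
def spinMatrix (a : Fin 21 → ℂ) : Matrix (Fin 8) (Fin 8) ℂ :=
  !![0, a 2 + a 9 - a 20, -a 1 + a 13 + a 19, a 0 - a 14 + a 18, -a 6 - a 11 - a 17,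
      a 3 + a 12 - a 16, a 4 - a 8 + a 15, a 5 + a 7 - a 10;
    -a 2 - a 9 + a 20, 0, -a 0, -a 1, -a 3, -a 6, -a 10, -a 15;
    a 1 - a 13 - a 19, a 0, 0, -a 2, -a 4, -a 7, -a 11, -a 16;
    -a 0 + a 14 - a 18, a 1, a 2, 0, -a 5, -a 8, -a 12, -a 17;
    a 6 + a 11 + a 17, a 3, a 4, a 5, 0, -a 9, -a 13, -a 18;
    -a 3 - a 12 + a 16, a 6, a 7, a 8, a 9, 0, -a 14, -a 19;
    -a 4 + a 8 - a 15, a 10, a 11, a 12, a 13, a 14, 0, -a 20;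
    -a 5 - a 7 + a 10, a 15, a 16, a 17, a 18, a 19, a 20, 0]

theorem spinMatrix_add (a b : Fin 21 → ℂ) :
    spinMatrix (a + b) = spinMatrix a + spinMatrix b := by
  simp only [spinMatrix, Pi.add_apply, Matrix.of_add_of, Matrix.cons_add_cons,
    Matrix.empty_add_empty]
  congr! 1
  ring_nf

theorem spinMatrix_smul (c : ℂ) (a : Fin 21 → ℂ) : spinMatrix (c • a) = c • spinMatrix a := by
  simp only [spinMatrix, Pi.smul_apply, Matrix.smul_of, Matrix.smul_cons, Matrix.smul_empty,
    smul_eq_mul]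
  congr! 1
  ring_nf

/-- The operators on the octonions with matrix `spinMatrix a`. -/
def spinMap : (Fin 21 → ℂ) →ₗ[ℂ] Oct →ₗ[ℂ] Oct where
  toFun a := coords.symm.conj (Matrix.toLin' (spinMatrix a))
  map_add' a b := by rw [spinMatrix_add, map_add, map_add]
  map_smul' c a := by rw [spinMatrix_smul, map_smul, map_smul, RingHom.id_apply]

theorem coords_spinMap (a : Fin 21 → ℂ) (x : Oct) :
    coords (spinMap a x) = (spinMatrix a).mulVec (coords x) := by
  simp [spinMap, LinearEquiv.conj_apply]

theorem spinMatrix_injective : Function.Injective spinMatrix := by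
  intro a b h
  have e (i j : Fin 8) : spinMatrix a i j = spinMatrix b i j := by rw [h]
  ext i
  fin_cases i
  exacts [e 2 1, e 3 1, e 3 2, e 4 1, e 4 2, e 4 3, e 5 1, e 5 2, e 5 3, e 5 4, e 6 1, e 6 2,
    e 6 3, e 6 4, e 6 5, e 7 1, e 7 2, e 7 3, e 7 4, e 7 5, e 7 6]

theorem spinMap_injective : Function.Injective spinMap := fun _ _ h ↦
  spinMatrix_injective (Matrix.toLin'.injective (coords.symm.conj.injective h))

set_option maxHeartbeats 4000000 in
theorem spinMatrix_mulVec_triple (a : Fin 21 → ℂ) (u v w : Fin 8 → ℂ) :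
    (spinMatrix a).mulVec (triple u v w) =
      triple ((spinMatrix a).mulVec u) v w + triple u ((spinMatrix a).mulVec v) w
        + triple u v ((spinMatrix a).mulVec w) := by
  ext i
  fin_cases i <;>
    simp [spinMatrix, triple, minor, Matrix.mulVec, dotProduct, Fin.sum_univ_succ] <;> ring

theorem isDer_spinMap (a : Fin 21 → ℂ) : IsDer (spinMap a) := by
  intro x y z
  apply coords.injective
  simp only [map_add, coords_tmul, coords_spinMap, spinMatrix_mulVec_triple]

set_option maxHeartbeats 4000000 in
theorem exists_spinMatrix_eq {M : Matrix (Fin 8) (Fin 8) ℂ}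
    (hM : ∀ u v w, M.mulVec (triple u v w) =
      triple (M.mulVec u) v w + triple u (M.mulVec v) w + triple u v (M.mulVec w)) :
    ∃ a, spinMatrix a = M := by
  have h0 := hM (Pi.single 0 1) (Pi.single 1 1) (Pi.single 2 1)
  have h1 := hM (Pi.single 0 1) (Pi.single 1 1) (Pi.single 4 1)
  have h2 := hM (Pi.single 0 1) (Pi.single 1 1) (Pi.single 6 1)
  have h3 := hM (Pi.single 0 1) (Pi.single 2 1) (Pi.single 4 1)
  have h4 := hM (Pi.single 1 1) (Pi.single 2 1) (Pi.single 7 1)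
  have h5 := hM (Pi.single 0 1) (Pi.single 1 1) (Pi.single 3 1)
  have h6 := hM (Pi.single 0 1) (Pi.single 2 1) (Pi.single 3 1)
  have h7 := hM (Pi.single 0 1) (Pi.single 4 1) (Pi.single 5 1)
  clear hM
  simp [triple, minor, Matrix.mulVec, dotProduct, Fin.sum_univ_succ, funext_iff,
    Fin.forall_fin_succ] at h0 h1 h2 h3 h4 h5 h6 h7
  refine ⟨![M 2 1, M 3 1, M 3 2, M 4 1, M 4 2, M 4 3, M 5 1, M 5 2, M 5 3, M 5 4, M 6 1,
    M 6 2, M 6 3, M 6 4, M 6 5, M 7 1, M 7 2, M 7 3, M 7 4, M 7 5, M 7 6], ?_⟩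
  ext i j
  fin_cases i <;> fin_cases j <;> simp [spinMatrix] <;> grind

theorem IsDer.exists_spinMap_eq {D : Oct →ₗ[ℂ] Oct} (hD : IsDer D) :
    ∃ a, spinMap a = D := by
  obtain ⟨a, ha⟩ := exists_spinMatrix_eq (M := LinearMap.toMatrix' (coords.conj D)) (by
    intro u v w
    have h := congrArg coords (hD (coords.symm u) (coords.symm v) (coords.symm w))
    rw [tmul_coords_symm] at h
    simpa [coords_tmul, LinearEquiv.conj_apply, ← Matrix.toLin'_apply] using h)
  refine ⟨a, LinearMap.ext fun x ↦ coords.injective ?_⟩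
  rw [coords_spinMap, ha]
  simp [← Matrix.toLin'_apply, LinearEquiv.conj_apply]

end Oct

open Oct in
/-- The derivations of the ternary Malcev algebra `M₈` form a `ℂ`-linear
subspace of the endomorphisms of the octonions, of dimension `21`. -/
theorem der_M8_submodule_finrank_21 :
    ∃ S : Submodule ℂ (Oct →ₗ[ℂ] Oct),
      (∀ D : Oct →ₗ[ℂ] Oct, D ∈ S ↔ IsDer D) ∧ Module.finrank ℂ S = 21 := by
  refine ⟨LinearMap.range spinMap, fun D ↦ ⟨?_, fun hD ↦ hD.exists_spinMap_eq⟩, ?_⟩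
  · rintro ⟨a, rfl⟩
    exact isDer_spinMap a
  · exact (LinearMap.finrank_range_of_inj spinMap_injective).trans (by simp)
end
end

section
/- A ℂ-linear map ∇ : O → O is a local derivation of the ternary Malcev algebra M_8 if and only if ⟨∇(x), y⟩ + ⟨x, ∇(y)⟩ = 0 for all x, y ∈ O (equivalently, if and only if the matrix of ∇ with respect to the orthonormal basis e_1,…,e_8 is antisymmetric). -/
noncomputable section

namespace Oct

theorem form_eq_s12 (x y : Oct) : form x y =
    x.1.re * y.1.re + x.1.imI * y.1.imI + x.1.imJ * y.1.imJ + x.1.imK * y.1.imK +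
    (x.2.re * y.2.re + x.2.imI * y.2.imI + x.2.imJ * y.2.imJ + x.2.imK * y.2.imK) := by
  simp [form, mul, conj]
  ring


theorem fst_re_tmul (x y z : Oct) : (tmul x y z).1.re =
      (x.1.imJ * y.1.imK + x.2.re * y.2.imI + x.2.imK * y.2.imJ
        - x.1.imK * y.1.imJ - x.2.imI * y.2.re - x.2.imJ * y.2.imK) * z.1.imI +
      (x.1.imK * y.1.imI + x.2.re * y.2.imJ + x.2.imI * y.2.imK
        - x.1.imI * y.1.imK - x.2.imJ * y.2.re - x.2.imK * y.2.imI) * z.1.imJ +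
      (x.1.imI * y.1.imJ + x.2.re * y.2.imK + x.2.imJ * y.2.imI
        - x.1.imJ * y.1.imI - x.2.imI * y.2.imJ - x.2.imK * y.2.re) * z.1.imK +
      (x.2.imI * y.1.imI + x.2.imJ * y.1.imJ + x.2.imK * y.1.imK
        - x.1.imI * y.2.imI - x.1.imJ * y.2.imJ - x.1.imK * y.2.imK) * z.2.re +
      (x.1.imI * y.2.re + x.1.imK * y.2.imJ + x.2.imK * y.1.imJ
        - x.1.imJ * y.2.imK - x.2.re * y.1.imI - x.2.imJ * y.1.imK) * z.2.imI +
      (x.1.imI * y.2.imK + x.1.imJ * y.2.re + x.2.imI * y.1.imK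
        - x.1.imK * y.2.imI - x.2.re * y.1.imJ - x.2.imK * y.1.imI) * z.2.imJ +
      (x.1.imJ * y.2.imI + x.1.imK * y.2.re + x.2.imJ * y.1.imI
        - x.1.imI * y.2.imJ - x.2.re * y.1.imK - x.2.imI * y.1.imJ) * z.2.imK := by
  simp [tmul, mul, conj, form_eq_s12]
  ring

theorem fst_imI_tmul (x y z : Oct) : (tmul x y z).1.imI =
      (x.1.imK * y.1.imJ + x.2.imI * y.2.re + x.2.imJ * y.2.imK
        - x.1.imJ * y.1.imK - x.2.re * y.2.imI - x.2.imK * y.2.imJ) * z.1.re +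
      (x.1.re * y.1.imK + x.2.re * y.2.imK + x.2.imJ * y.2.imI
        - x.1.imK * y.1.re - x.2.imI * y.2.imJ - x.2.imK * y.2.re) * z.1.imJ +
      (x.1.imJ * y.1.re + x.2.imJ * y.2.re + x.2.imK * y.2.imI
        - x.1.re * y.1.imJ - x.2.re * y.2.imJ - x.2.imI * y.2.imK) * z.1.imK +
      (x.1.re * y.2.imI + x.1.imK * y.2.imJ + x.2.imK * y.1.imJ
        - x.1.imJ * y.2.imK - x.2.imI * y.1.re - x.2.imJ * y.1.imK) * z.2.re +
      (x.1.imJ * y.2.imJ + x.1.imK * y.2.imK + x.2.re * y.1.re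
        - x.1.re * y.2.re - x.2.imJ * y.1.imJ - x.2.imK * y.1.imK) * z.2.imI +
      (x.2.re * y.1.imK + x.2.imI * y.1.imJ + x.2.imK * y.1.re
        - x.1.re * y.2.imK - x.1.imJ * y.2.imI - x.1.imK * y.2.re) * z.2.imJ +
      (x.1.re * y.2.imJ + x.1.imJ * y.2.re + x.2.imI * y.1.imK
        - x.1.imK * y.2.imI - x.2.re * y.1.imJ - x.2.imJ * y.1.re) * z.2.imK := by
  simp [tmul, mul, conj, form_eq_s12]
  ring

theorem fst_imJ_tmul (x y z : Oct) : (tmul x y z).1.imJ =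
      (x.1.imI * y.1.imK + x.2.imJ * y.2.re + x.2.imK * y.2.imI
        - x.1.imK * y.1.imI - x.2.re * y.2.imJ - x.2.imI * y.2.imK) * z.1.re +
      (x.1.imK * y.1.re + x.2.imI * y.2.imJ + x.2.imK * y.2.re
        - x.1.re * y.1.imK - x.2.re * y.2.imK - x.2.imJ * y.2.imI) * z.1.imI +
      (x.1.re * y.1.imI + x.2.re * y.2.imI + x.2.imK * y.2.imJ
        - x.1.imI * y.1.re - x.2.imI * y.2.re - x.2.imJ * y.2.imK) * z.1.imK +
      (x.1.re * y.2.imJ + x.1.imI * y.2.imK + x.2.imI * y.1.imK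
        - x.1.imK * y.2.imI - x.2.imJ * y.1.re - x.2.imK * y.1.imI) * z.2.re +
      (x.1.re * y.2.imK + x.1.imK * y.2.re + x.2.imJ * y.1.imI
        - x.1.imI * y.2.imJ - x.2.re * y.1.imK - x.2.imK * y.1.re) * z.2.imI +
      (x.1.imI * y.2.imI + x.1.imK * y.2.imK + x.2.re * y.1.re
        - x.1.re * y.2.re - x.2.imI * y.1.imI - x.2.imK * y.1.imK) * z.2.imJ +
      (x.2.re * y.1.imI + x.2.imI * y.1.re + x.2.imJ * y.1.imK
        - x.1.re * y.2.imI - x.1.imI * y.2.re - x.1.imK * y.2.imJ) * z.2.imK := by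
  simp [tmul, mul, conj, form_eq_s12]
  ring

theorem fst_imK_tmul (x y z : Oct) : (tmul x y z).1.imK =
      (x.1.imJ * y.1.imI + x.2.imI * y.2.imJ + x.2.imK * y.2.re
        - x.1.imI * y.1.imJ - x.2.re * y.2.imK - x.2.imJ * y.2.imI) * z.1.re +
      (x.1.re * y.1.imJ + x.2.re * y.2.imJ + x.2.imI * y.2.imK
        - x.1.imJ * y.1.re - x.2.imJ * y.2.re - x.2.imK * y.2.imI) * z.1.imI +
      (x.1.imI * y.1.re + x.2.imI * y.2.re + x.2.imJ * y.2.imK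
        - x.1.re * y.1.imI - x.2.re * y.2.imI - x.2.imK * y.2.imJ) * z.1.imJ +
      (x.1.re * y.2.imK + x.1.imJ * y.2.imI + x.2.imJ * y.1.imI
        - x.1.imI * y.2.imJ - x.2.imI * y.1.imJ - x.2.imK * y.1.re) * z.2.re +
      (x.2.re * y.1.imJ + x.2.imJ * y.1.re + x.2.imK * y.1.imI
        - x.1.re * y.2.imJ - x.1.imI * y.2.imK - x.1.imJ * y.2.re) * z.2.imI +
      (x.1.re * y.2.imI + x.1.imI * y.2.re + x.2.imK * y.1.imJ
        - x.1.imJ * y.2.imK - x.2.re * y.1.imI - x.2.imI * y.1.re) * z.2.imJ +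
      (x.1.imI * y.2.imI + x.1.imJ * y.2.imJ + x.2.re * y.1.re
        - x.1.re * y.2.re - x.2.imI * y.1.imI - x.2.imJ * y.1.imJ) * z.2.imK := by
  simp [tmul, mul, conj, form_eq_s12]
  ring

theorem snd_re_tmul (x y z : Oct) : (tmul x y z).2.re =
      (x.1.imI * y.2.imI + x.1.imJ * y.2.imJ + x.1.imK * y.2.imK
        - x.2.imI * y.1.imI - x.2.imJ * y.1.imJ - x.2.imK * y.1.imK) * z.1.re +
      (x.1.imJ * y.2.imK + x.2.imI * y.1.re + x.2.imJ * y.1.imK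
        - x.1.re * y.2.imI - x.1.imK * y.2.imJ - x.2.imK * y.1.imJ) * z.1.imI +
      (x.1.imK * y.2.imI + x.2.imJ * y.1.re + x.2.imK * y.1.imI
        - x.1.re * y.2.imJ - x.1.imI * y.2.imK - x.2.imI * y.1.imK) * z.1.imJ +
      (x.1.imI * y.2.imJ + x.2.imI * y.1.imJ + x.2.imK * y.1.re
        - x.1.re * y.2.imK - x.1.imJ * y.2.imI - x.2.imJ * y.1.imI) * z.1.imK +
      (x.1.re * y.1.imI + x.1.imJ * y.1.imK + x.2.imK * y.2.imJ
        - x.1.imI * y.1.re - x.1.imK * y.1.imJ - x.2.imJ * y.2.imK) * z.2.imI +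
      (x.1.re * y.1.imJ + x.1.imK * y.1.imI + x.2.imI * y.2.imK
        - x.1.imI * y.1.imK - x.1.imJ * y.1.re - x.2.imK * y.2.imI) * z.2.imJ +
      (x.1.re * y.1.imK + x.1.imI * y.1.imJ + x.2.imJ * y.2.imI
        - x.1.imJ * y.1.imI - x.1.imK * y.1.re - x.2.imI * y.2.imJ) * z.2.imK := by
  simp [tmul, mul, conj, form_eq_s12]
  ring

theorem snd_imI_tmul (x y z : Oct) : (tmul x y z).2.imI =
      (x.1.imJ * y.2.imK + x.2.re * y.1.imI + x.2.imJ * y.1.imK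
        - x.1.imI * y.2.re - x.1.imK * y.2.imJ - x.2.imK * y.1.imJ) * z.1.re +
      (x.1.re * y.2.re + x.2.imJ * y.1.imJ + x.2.imK * y.1.imK
        - x.1.imJ * y.2.imJ - x.1.imK * y.2.imK - x.2.re * y.1.re) * z.1.imI +
      (x.1.imI * y.2.imJ + x.2.re * y.1.imK + x.2.imK * y.1.re
        - x.1.re * y.2.imK - x.1.imK * y.2.re - x.2.imJ * y.1.imI) * z.1.imJ +
      (x.1.re * y.2.imJ + x.1.imI * y.2.imK + x.1.imJ * y.2.re
        - x.2.re * y.1.imJ - x.2.imJ * y.1.re - x.2.imK * y.1.imI) * z.1.imK +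
      (x.1.imI * y.1.re + x.1.imK * y.1.imJ + x.2.imJ * y.2.imK
        - x.1.re * y.1.imI - x.1.imJ * y.1.imK - x.2.imK * y.2.imJ) * z.2.re +
      (x.1.imJ * y.1.imI + x.1.imK * y.1.re + x.2.imK * y.2.re
        - x.1.re * y.1.imK - x.1.imI * y.1.imJ - x.2.re * y.2.imK) * z.2.imJ +
      (x.1.re * y.1.imJ + x.1.imK * y.1.imI + x.2.re * y.2.imJ
        - x.1.imI * y.1.imK - x.1.imJ * y.1.re - x.2.imJ * y.2.re) * z.2.imK := by
  simp [tmul, mul, conj, form_eq_s12]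
  ring

theorem snd_imJ_tmul (x y z : Oct) : (tmul x y z).2.imJ =
      (x.1.imK * y.2.imI + x.2.re * y.1.imJ + x.2.imK * y.1.imI
        - x.1.imI * y.2.imK - x.1.imJ * y.2.re - x.2.imI * y.1.imK) * z.1.re +
      (x.1.re * y.2.imK + x.1.imJ * y.2.imI + x.1.imK * y.2.re
        - x.2.re * y.1.imK - x.2.imI * y.1.imJ - x.2.imK * y.1.re) * z.1.imI +
      (x.1.re * y.2.re + x.2.imI * y.1.imI + x.2.imK * y.1.imK
        - x.1.imI * y.2.imI - x.1.imK * y.2.imK - x.2.re * y.1.re) * z.1.imJ +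
      (x.1.imJ * y.2.imK + x.2.re * y.1.imI + x.2.imI * y.1.re
        - x.1.re * y.2.imI - x.1.imI * y.2.re - x.2.imK * y.1.imJ) * z.1.imK +
      (x.1.imI * y.1.imK + x.1.imJ * y.1.re + x.2.imK * y.2.imI
        - x.1.re * y.1.imJ - x.1.imK * y.1.imI - x.2.imI * y.2.imK) * z.2.re +
      (x.1.re * y.1.imK + x.1.imI * y.1.imJ + x.2.re * y.2.imK
        - x.1.imJ * y.1.imI - x.1.imK * y.1.re - x.2.imK * y.2.re) * z.2.imI +
      (x.1.imI * y.1.re + x.1.imK * y.1.imJ + x.2.imI * y.2.re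
        - x.1.re * y.1.imI - x.1.imJ * y.1.imK - x.2.re * y.2.imI) * z.2.imK := by
  simp [tmul, mul, conj, form_eq_s12]
  ring

theorem snd_imK_tmul (x y z : Oct) : (tmul x y z).2.imK =
      (x.1.imI * y.2.imJ + x.2.re * y.1.imK + x.2.imI * y.1.imJ
        - x.1.imJ * y.2.imI - x.1.imK * y.2.re - x.2.imJ * y.1.imI) * z.1.re +
      (x.1.imK * y.2.imI + x.2.re * y.1.imJ + x.2.imJ * y.1.re
        - x.1.re * y.2.imJ - x.1.imJ * y.2.re - x.2.imI * y.1.imK) * z.1.imI +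
      (x.1.re * y.2.imI + x.1.imI * y.2.re + x.1.imK * y.2.imJ
        - x.2.re * y.1.imI - x.2.imI * y.1.re - x.2.imJ * y.1.imK) * z.1.imJ +
      (x.1.re * y.2.re + x.2.imI * y.1.imI + x.2.imJ * y.1.imJ
        - x.1.imI * y.2.imI - x.1.imJ * y.2.imJ - x.2.re * y.1.re) * z.1.imK +
      (x.1.imJ * y.1.imI + x.1.imK * y.1.re + x.2.imI * y.2.imJ
        - x.1.re * y.1.imK - x.1.imI * y.1.imJ - x.2.imJ * y.2.imI) * z.2.re +
      (x.1.imI * y.1.imK + x.1.imJ * y.1.re + x.2.imJ * y.2.re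
        - x.1.re * y.1.imJ - x.1.imK * y.1.imI - x.2.re * y.2.imJ) * z.2.imI +
      (x.1.re * y.1.imI + x.1.imJ * y.1.imK + x.2.re * y.2.imI
        - x.1.imI * y.1.re - x.1.imK * y.1.imJ - x.2.imI * y.2.re) * z.2.imJ := by
  simp [tmul, mul, conj, form_eq_s12]
  ring


theorem tmul_add_right (x y z z' : Oct) : tmul x y (z + z') = tmul x y z + tmul x y z' := by
  ext <;>
  simp only [fst_re_tmul, fst_imI_tmul, fst_imJ_tmul, fst_imK_tmul, snd_re_tmul, snd_imI_tmul,
    snd_imJ_tmul, snd_imK_tmul, Prod.fst_add, Prod.snd_add, Quaternion.re_add, Quaternion.imI_add,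
    Quaternion.imJ_add, Quaternion.imK_add] <;>
  ring

theorem tmul_smul_right (c : ℂ) (x y z : Oct) : tmul x y (c • z) = c • tmul x y z := by
  ext <;>
  simp only [fst_re_tmul, fst_imI_tmul, fst_imJ_tmul, fst_imK_tmul, snd_re_tmul, snd_imI_tmul,
    snd_imJ_tmul, snd_imK_tmul, Prod.smul_fst, Prod.smul_snd, Quaternion.re_smul,
    Quaternion.imI_smul, Quaternion.imJ_smul, Quaternion.imK_smul, smul_eq_mul] <;>
  ring

theorem tmul_swap (x y z : Oct) : tmul y x z = -tmul x y z := by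
  ext <;>
  simp only [fst_re_tmul, fst_imI_tmul, fst_imJ_tmul, fst_imK_tmul, snd_re_tmul, snd_imI_tmul,
    snd_imJ_tmul, snd_imK_tmul, Prod.fst_neg, Prod.snd_neg, Quaternion.re_neg, Quaternion.imI_neg,
    Quaternion.imJ_neg, Quaternion.imK_neg] <;>
  ring

theorem tmul_rotate (x y z : Oct) : tmul x y z = tmul y z x := by
  ext <;>
  simp only [fst_re_tmul, fst_imI_tmul, fst_imJ_tmul, fst_imK_tmul, snd_re_tmul, snd_imI_tmul,
    snd_imJ_tmul, snd_imK_tmul] <;>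
  ring

theorem tmul_add_left (x x' y z : Oct) : tmul (x + x') y z = tmul x y z + tmul x' y z := by
  simp only [tmul_rotate _ y z, tmul_add_right]

theorem tmul_add_mid (x y y' z : Oct) : tmul x (y + y') z = tmul x y z + tmul x y' z := by
  simp only [tmul_rotate x, tmul_add_left]

theorem tmul_smul_left (c : ℂ) (x y z : Oct) : tmul (c • x) y z = c • tmul x y z := by
  simp only [tmul_rotate _ y z, tmul_smul_right]

theorem tmul_smul_mid (c : ℂ) (x y z : Oct) : tmul x (c • y) z = c • tmul x y z := by
  simp only [tmul_rotate x, tmul_smul_left]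

theorem tmul_self_left (x y : Oct) : tmul x x y = 0 := by
  have h := tmul_swap x x y
  linear_combination (norm := module) (1 / 2 : ℂ) • h

theorem form_tmul_self (x y z : Oct) : form (tmul x y z) y = 0 := by
  simp only [form_eq_s12, fst_re_tmul, fst_imI_tmul, fst_imJ_tmul, fst_imK_tmul, snd_re_tmul,
    snd_imI_tmul, snd_imJ_tmul, snd_imK_tmul]
  ring

theorem tmul_tmul_add_tmul_tmul (x x' y z : Oct) :
    tmul x y (tmul x' y z) + tmul x' y (tmul x y z) =
      (-2 * (form x x' * form y y - form x y * form x' y)) • z +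
      (form y y * form x' z - form x' y * form y z) • x +
      (form y y * form x z - form x y * form y z) • x' +
      (2 * form x x' * form y z - form x y * form x' z - form x' y * form x z) • y := by
  ext <;>
  simp only [form_eq_s12, fst_re_tmul, fst_imI_tmul, fst_imJ_tmul, fst_imK_tmul, snd_re_tmul,
    snd_imI_tmul, snd_imJ_tmul, snd_imK_tmul, Prod.fst_add, Prod.snd_add, Prod.smul_fst,
    Prod.smul_snd, Quaternion.re_add, Quaternion.imI_add, Quaternion.imJ_add, Quaternion.imK_add,
    Quaternion.re_smul, Quaternion.imI_smul, Quaternion.imJ_smul, Quaternion.imK_smul,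
    smul_eq_mul] <;>
  ring

theorem tmul_neg_right (x y z : Oct) : tmul x y (-z) = -tmul x y z := by
  have h := tmul_smul_right (-1) x y z
  rw [show (-1 : ℂ) • z = -z by module] at h
  linear_combination (norm := module) h

theorem form_comm_s12 (x y : Oct) : form x y = form y x := by
  simp only [form_eq_s12]
  ring

theorem form_add_left_s12 (x x' y : Oct) : form (x + x') y = form x y + form x' y := by
  simp only [form_eq_s12, Prod.fst_add, Prod.snd_add, Quaternion.re_add, Quaternion.imI_add,
    Quaternion.imJ_add, Quaternion.imK_add]
  ring

theorem form_smul_left_s12 (c : ℂ) (x y : Oct) : form (c • x) y = c * form x y := by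
  simp only [form_eq_s12, Prod.smul_fst, Prod.smul_snd, Quaternion.re_smul, Quaternion.imI_smul,
    Quaternion.imJ_smul, Quaternion.imK_smul, smul_eq_mul]
  ring

theorem tmul_tmul_add_tmul_tmul_mid (x y y' z : Oct) :
    tmul x y (tmul x y' z) + tmul x y' (tmul x y z) =
      (-2 * (form x x * form y y' - form x y * form x y')) • z +
      (2 * form y y' * form x z - form x y * form y' z - form x y' * form y z) • x +
      (form x x * form y' z - form x y' * form x z) • y +
      (form x x * form y z - form x y * form x z) • y' := by
  have h := tmul_tmul_add_tmul_tmul y y' x z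
  simp only [tmul_swap x y, tmul_swap x y', tmul_neg_right, neg_neg, form_comm_s12 y x,
    form_comm_s12 y' x] at h
  linear_combination (norm := module) h

theorem tmul_tmul_self (x y z : Oct) :
    tmul x y (tmul x y z) =
      (-(form x x * form y y - form x y ^ 2)) • z +
      (form y y * form x z - form x y * form y z) • x +
      (form x x * form y z - form x y * form x z) • y := by
  linear_combination (norm := module) (1 / 2 : ℂ) • tmul_tmul_add_tmul_tmul x x y z

/-- The bilinear form `⟨·,·⟩` as a bundled bilinear map. -/
def formBilin : LinearMap.BilinForm ℂ Oct :=
  LinearMap.mk₂ ℂ form form_add_left_s12 form_smul_left_s12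
    (fun x y z => by simp only [form_comm_s12 x, form_add_left_s12])
    (fun c x y => by simp only [form_comm_s12 x, form_smul_left_s12, smul_eq_mul])

theorem form_add_right_s12 (x y y' : Oct) : form x (y + y') = form x y + form x y' :=
  map_add (formBilin x) y y'


/-- The standard orthonormal basis of the octonions. -/
def e : Fin 8 → Oct :=
  ![(⟨1, 0, 0, 0⟩, ⟨0, 0, 0, 0⟩), (⟨0, 1, 0, 0⟩, ⟨0, 0, 0, 0⟩),
    (⟨0, 0, 1, 0⟩, ⟨0, 0, 0, 0⟩), (⟨0, 0, 0, 1⟩, ⟨0, 0, 0, 0⟩),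
    (⟨0, 0, 0, 0⟩, ⟨1, 0, 0, 0⟩), (⟨0, 0, 0, 0⟩, ⟨0, 1, 0, 0⟩),
    (⟨0, 0, 0, 0⟩, ⟨0, 0, 1, 0⟩), (⟨0, 0, 0, 0⟩, ⟨0, 0, 0, 1⟩)]

theorem form_e_e (i j : Fin 8) : form (e i) (e j) = if i = j then 1 else 0 := by
  rw [form_eq_s12]
  fin_cases i <;> fin_cases j <;> simp [e]

theorem sum_form_smul_e (x : Oct) : ∑ i, form (e i) x • e i = x := by
  simp only [Fin.sum_univ_eight, form_eq_s12]
  ext <;>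
  simp only [Prod.fst_add, Prod.snd_add, Prod.smul_fst,
    Prod.smul_snd, Quaternion.re_add, Quaternion.imI_add, Quaternion.imJ_add, Quaternion.imK_add,
    Quaternion.re_smul, Quaternion.imI_smul, Quaternion.imJ_smul, Quaternion.imK_smul,
    smul_eq_mul] <;>
  simp [e]

theorem eq_zero_of_forall_apply_e (L : Oct →ₗ[ℂ] ℂ) (h : ∀ i, L (e i) = 0) (x : Oct) :
    L x = 0 := by
  rw [← sum_form_smul_e x, map_sum]
  exact Finset.sum_eq_zero fun i _ => by rw [map_smul, h, smul_zero]

theorem exists_form_eq_one {x : Oct} (hx : x ≠ 0) : ∃ v, form v x = 1 := by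
  obtain ⟨i, hi⟩ : ∃ i, form (e i) x ≠ 0 := by
    by_contra! h
    have hs := sum_form_smul_e x
    simp only [h, Fin.sum_univ_eight] at hs
    exact hx (by linear_combination (norm := module) -hs)
  exact ⟨(form (e i) x)⁻¹ • e i, by rw [form_smul_left_s12, inv_mul_cancel₀ hi]⟩

theorem IsDer.form_apply_of_orthonormal {D : Oct →ₗ[ℂ] Oct} (hD : IsDer D) {x y z : Oct}
    (hxx : form x x = 1) (hyy : form y y = 1) (hzz : form z z = 1)
    (hxy : form x y = 0) (hyz : form y z = 0) (hxz : form x z = 0) :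
    form (D x) x + form (D y) y = 0 ∧ form (D x) z + form x (D z) = 0 := by
  have hyx : form y x = 0 := by rw [form_comm_s12, hxy]
  have hzx : form z x = 0 := by rw [form_comm_s12, hxz]
  have h : D (tmul x y (tmul x y z)) = D ((-1 : ℂ) • z) := by
    rw [tmul_tmul_self, hxx, hyy, hxy, hyz, hxz]
    congr 1
    module
  rw [hD, hD, tmul_add_right, tmul_add_right, map_smul] at h
  have h₁ := tmul_tmul_add_tmul_tmul x (D x) y z
  have h₂ := tmul_tmul_add_tmul_tmul_mid x y (D y) z
  have h₃ := tmul_tmul_self x y (D z)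
  simp only [hxx, hyy, hxy, hyz, hxz] at h₁ h₂ h₃
  have key : (-2 * (form x (D x) + form y (D y))) • z +
      (form (D x) z + form x (D z)) • x + (form (D y) z + form y (D z)) • y = 0 := by
    linear_combination (norm := module) h - h₁ - h₂ - h₃
  have kz := congrArg (form · z) key
  have kx := congrArg (form · x) key
  have h0 (t : Oct) : form 0 t = 0 := by simpa using form_smul_left_s12 0 0 t
  simp only [form_add_left_s12, form_smul_left_s12, hxx, hyx, hzx, hzz, hyz, hxz, h0] at kz kx
  constructor
  · rw [form_comm_s12 (D x), form_comm_s12 (D y)]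
    linear_combination -1 / 2 * kz
  · linear_combination kx

/-- Derivations of `M₈` are skew-adjoint. -/
theorem IsDer.form_apply_add_form_apply {D : Oct →ₗ[ℂ] Oct} (hD : IsDer D) (x y : Oct) :
    form (D x) y + form x (D y) = 0 := by
  have third (i j : Fin 8) : ∃ k, k ≠ i ∧ k ≠ j := by decide +revert
  have sum_zero {i j : Fin 8} (hij : i ≠ j) :
      form (D (e i)) (e i) + form (D (e j)) (e j) = 0 := by
    obtain ⟨k, hki, hkj⟩ := third i j
    exact (hD.form_apply_of_orthonormal (z := e k) (by simp [form_e_e]) (by simp [form_e_e])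
      (by simp [form_e_e]) (by simp [form_e_e, hij]) (by simp [form_e_e, hkj.symm])
      (by simp [form_e_e, hki.symm])).1
  have basis (i j : Fin 8) : form (D (e i)) (e j) + form (e i) (D (e j)) = 0 := by
    obtain ⟨k, hki, hkj⟩ := third i j
    rcases eq_or_ne i j with rfl | hij
    · obtain ⟨l, hli, hlk⟩ := third i k
      rw [form_comm_s12 (e i)]
      linear_combination sum_zero hki + sum_zero hli - sum_zero hlk
    · exact (hD.form_apply_of_orthonormal (y := e k) (by simp [form_e_e]) (by simp [form_e_e])
        (by simp [form_e_e]) (by simp [form_e_e, hki.symm]) (by simp [form_e_e, hkj])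
        (by simp [form_e_e, hij])).2
  have left (j : Fin 8) : form (D x) (e j) + form x (D (e j)) = 0 :=
    eq_zero_of_forall_apply_e (formBilin.flip (e j) ∘ₗ D + formBilin.flip (D (e j)))
      (fun i => basis i j) x
  exact eq_zero_of_forall_apply_e (formBilin (D x) + formBilin x ∘ₗ D) left y

theorem IsDer.add {D D' : Oct →ₗ[ℂ] Oct} (h : IsDer D) (h' : IsDer D') : IsDer (D + D') := by
  intro x y z
  simp only [LinearMap.add_apply, h x y z, h' x y z, tmul_add_left, tmul_add_mid, tmul_add_right]
  abel

theorem IsDer.smul {D : Oct →ₗ[ℂ] Oct} (h : IsDer D) (c : ℂ) : IsDer (c • D) := by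
  intro x y z
  simp only [LinearMap.smul_apply, h x y z, tmul_smul_left, tmul_smul_mid, tmul_smul_right,
    smul_add]

theorem IsDer.commutator {D D' : Oct →ₗ[ℂ] Oct} (h : IsDer D) (h' : IsDer D') :
    IsDer (D ∘ₗ D' + (-1 : ℂ) • (D' ∘ₗ D)) := by
  intro x y z
  simp only [LinearMap.add_apply, LinearMap.smul_apply, LinearMap.comp_apply, h _ _ _, h' _ _ _,
    map_add, tmul_add_left, tmul_add_mid, tmul_add_right, tmul_smul_left, tmul_smul_mid,
    tmul_smul_right]
  module

/-- The inner derivation of `M₈` attached to a pair of octonions. -/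
def innerDer (u v : Oct) : Oct →ₗ[ℂ] Oct where
  toFun z := (3 * form v z) • u - (3 * form u z) • v - tmul u v z
  map_add' a b := by
    simp only [form_add_right_s12, tmul_add_right]
    module
  map_smul' c a := by
    simp only [form_comm_s12 _ (c • a), form_smul_left_s12, tmul_smul_right, form_comm_s12 a, RingHom.id_apply]
    module

theorem innerDer_apply (u v z : Oct) :
    innerDer u v z = (3 * form v z) • u - (3 * form u z) • v - tmul u v z := rfl


set_option maxHeartbeats 4000000 in
theorem isDer_innerDer_one (v : Oct) : IsDer (innerDer one v) := by
  intro x y z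
  ext <;>
  simp only [innerDer_apply, form_eq_s12, fst_re_tmul, fst_imI_tmul, fst_imJ_tmul, fst_imK_tmul,
    snd_re_tmul, snd_imI_tmul, snd_imJ_tmul, snd_imK_tmul, Prod.fst_add, Prod.snd_add,
    Prod.fst_sub, Prod.snd_sub, Prod.smul_fst, Prod.smul_snd, Quaternion.re_add,
    Quaternion.imI_add, Quaternion.imJ_add, Quaternion.imK_add, Quaternion.re_sub,
    Quaternion.imI_sub, Quaternion.imJ_sub, Quaternion.imK_sub, Quaternion.re_smul,
    Quaternion.imI_smul, Quaternion.imJ_smul, Quaternion.imK_smul, smul_eq_mul,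
    one, Quaternion.re_one, Quaternion.imI_one, Quaternion.imJ_one, Quaternion.imK_one,
    Quaternion.re_zero, Quaternion.imI_zero, Quaternion.imJ_zero, Quaternion.imK_zero,
    mul_zero, zero_mul, mul_one, one_mul, add_zero, zero_add, sub_zero, zero_sub] <;>
  ring


theorem IsDer.apply_innerDer {D : Oct →ₗ[ℂ] Oct} (hD : IsDer D) (u v z : Oct) :
    D (innerDer u v z) - innerDer u v (D z) = innerDer (D u) v z + innerDer u (D v) z := by
  have hu := hD.form_apply_add_form_apply u z
  have hv := hD.form_apply_add_form_apply v z
  simp only [innerDer_apply, map_sub, map_smul, hD u v z, eq_neg_of_add_eq_zero_left hu,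
    eq_neg_of_add_eq_zero_left hv]
  module

theorem isDer_innerDer (u v : Oct) : IsDer (innerDer u v) := by
  have hu := isDer_innerDer_one u
  have hv := isDer_innerDer_one v
  have h11 : form one one = 1 := by
    rw [form_eq_s12, one, Quaternion.re_one, Quaternion.imI_one, Quaternion.imJ_one,
      Quaternion.imK_one, Quaternion.re_zero, Quaternion.imI_zero, Quaternion.imJ_zero,
      Quaternion.imK_zero]
    ring
  have h1 : innerDer one u one = (3 * form u one) • one + (-3 : ℂ) • u := by
    rw [innerDer_apply, tmul_rotate one u one, tmul_rotate u one one, tmul_self_left, h11]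
    module
  have key : innerDer u v = form u one • innerDer one v +
      ((1 / 3 : ℂ) • innerDer one (innerDer one u v) + (-1 / 3 : ℂ) •
        (innerDer one u ∘ₗ innerDer one v + (-1 : ℂ) • (innerDer one v ∘ₗ innerDer one u))) := by
    refine LinearMap.ext fun z => ?_
    have h := hu.apply_innerDer one v z
    have h2 : innerDer (innerDer one u one) v z =
        (3 * form u one) • innerDer one v z + (-3 : ℂ) • innerDer u v z := by
      rw [h1]
      simp only [innerDer_apply, form_add_left_s12, form_smul_left_s12, tmul_add_left, tmul_smul_left]
      module
    simp only [LinearMap.add_apply, LinearMap.smul_apply, LinearMap.comp_apply]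
    linear_combination (norm := module) (1 / 3 : ℂ) • h + (1 / 3 : ℂ) • h2
  rw [key]
  exact (hv.smul _).add (((isDer_innerDer_one _).smul _).add ((hu.commutator hv).smul _))

/-- Derivations map any nonzero `x` onto the whole hyperplane orthogonal to `x`. -/
theorem exists_isDer_apply_eq {x w : Oct} (hx : x ≠ 0) (hw : form w x = 0) :
    ∃ D : Oct →ₗ[ℂ] Oct, IsDer D ∧ D x = w := by
  by_cases hxx : form x x = 0
  · obtain ⟨v, hv⟩ := exists_form_eq_one hx
    have hu : form ((3 : ℂ) • w + tmul v x w) x = 0 := by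
      rw [form_add_left_s12, form_smul_left_s12, hw, form_tmul_self]
      ring
    have hN := tmul_tmul_self v x w
    rw [hxx, hv, form_comm_s12 x w, hw] at hN
    refine ⟨(1 / 8 : ℂ) • innerDer ((3 : ℂ) • w + tmul v x w) v +
      (-form v w / 24) • innerDer x v, ((isDer_innerDer _ _).smul _).add
      ((isDer_innerDer _ _).smul _), ?_⟩
    rw [LinearMap.add_apply, LinearMap.smul_apply, LinearMap.smul_apply, innerDer_apply,
      innerDer_apply, hu, hv, hxx, tmul_rotate x v x, tmul_rotate v x x, tmul_self_left,
      tmul_rotate _ v x, tmul_add_right, tmul_smul_right]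
    linear_combination (norm := module) (-1 / 8 : ℂ) • hN
  · refine ⟨(3 * form x x)⁻¹ • innerDer w x, (isDer_innerDer w x).smul _, ?_⟩
    rw [LinearMap.smul_apply, innerDer_apply, hw, tmul_rotate w x x, tmul_self_left]
    match_scalars <;> field_simp; ring

end Oct

open Oct in
/-- A `ℂ`-linear map on the octonions is a local derivation of the ternary
Malcev algebra `M₈` if and only if it is skew-adjoint with respect to the
bilinear form `⟨·,·⟩`. -/
theorem local_derivation_iff_skew_adjoint (nabla : Oct →ₗ[ℂ] Oct) :
    IsLocDer nabla ↔ ∀ x y : Oct, form (nabla x) y + form x (nabla y) = 0 := by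
  constructor
  · intro h
    have diag (x : Oct) : form (nabla x) x = 0 := by
      obtain ⟨D, hD, hx⟩ := h x
      have := hD.form_apply_add_form_apply x x
      rw [form_comm_s12 x] at this
      rw [hx]
      linear_combination this / 2
    intro x y
    have hxy := diag (x + y)
    rw [map_add, form_add_left_s12, form_add_right_s12, form_add_right_s12, diag, diag] at hxy
    rw [form_comm_s12 x]
    linear_combination hxy
  · intro h x
    rcases eq_or_ne x 0 with rfl | hx
    · exact ⟨innerDer 0 0, isDer_innerDer 0 0, by rw [map_zero, map_zero]⟩
    · have hw := h x x
      rw [form_comm_s12 x] at hw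
      obtain ⟨D, hD, hDx⟩ := exists_isDer_apply_eq hx
        (show form (nabla x) x = 0 by linear_combination hw / 2)
      exact ⟨D, hD, hDx.symm⟩
end
end
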